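/- arXiv:1211.1128 — 2 statements merged into one kernel-verified Lean document; each statement's English description precedes it below -/
import Mathlib

section
/- For every choice of parameters s = (s_1, (s_{i,j})_{1≤i≤3, 1≤j≤a_i−1}) ∈ ℂ^{μ_A−1} and every s_μ ∈ ℂ∖{0}, the Jacobian ring ℂ[x_1,x_2,x_3]/(∂F/∂x_1, ∂F/∂x_2, ∂F/∂x_3), where F(x) := F_A(x; s, s_μ), is a finite-dimensional ℂ-vector space of dimension exactly μ_A = a_1 + a_2 + a_3 − 1. -/
open MvPolynomial

/-- The universal unfolding `F_A` of the affine cusp polynomial of type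
`A = (a 0, a 1, a 2)`:
`F_A(x; s, s_μ) = x₁^{a₁} + x₂^{a₂} + x₃^{a₃} − s_μ⁻¹ x₁x₂x₃ + s₁ + Σᵢ Σ_{j=1}^{aᵢ−1} s_{i,j} xᵢʲ`. -/
noncomputable def cuspUnfolding (a : Fin 3 → ℕ) (s1 : ℂ) (sij : Fin 3 → ℕ → ℂ) (sμ : ℂ) :
    MvPolynomial (Fin 3) ℂ :=
  (∑ i, X i ^ a i) - C sμ⁻¹ * (X 0 * X 1 * X 2) + C s1
    + ∑ i, ∑ j ∈ Finset.Ico 1 (a i), C (sij i j) * X i ^ j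

/-- The Jacobian ideal `(∂F/∂x₁, ∂F/∂x₂, ∂F/∂x₃)`. -/
noncomputable def jacobianIdeal (F : MvPolynomial (Fin 3) ℂ) : Ideal (MvPolynomial (Fin 3) ℂ) :=
  Ideal.span (Set.range fun i : Fin 3 => pderiv i F)

section Weights

variable {σ K : Type*} [Field K]

/-- The space of polynomials all of whose monomials have `w`-weight less than `n`. -/
noncomputable def weightLT (K : Type*) [Field K] (w : σ → ℕ) (n : ℕ) :
    Submodule K (MvPolynomial σ K) :=
  restrictSupport K {m | Finsupp.weight w m < n}

theorem mem_weightLT {w : σ → ℕ} {n : ℕ} {p : MvPolynomial σ K} :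
    p ∈ weightLT K w n ↔ ∀ m ∈ p.support, Finsupp.weight w m < n := by
  simp [weightLT, mem_restrictSupport_iff, Set.subset_def]

theorem monomial_mem_weightLT {w : σ → ℕ} {n : ℕ} {m : σ →₀ ℕ} (h : Finsupp.weight w m < n)
    (c : K) : monomial m c ∈ weightLT K w n := by
  classical
  rw [mem_weightLT]
  intro k hk
  rw [Finset.mem_singleton.1 (support_monomial_subset hk)]
  exact h

theorem X_pow_mem_weightLT {w : σ → ℕ} {n k : ℕ} {i : σ} (h : k * w i < n) :
    (X i ^ k : MvPolynomial σ K) ∈ weightLT K w n := by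
  rw [X_pow_eq_monomial]
  exact monomial_mem_weightLT (by simpa [Finsupp.weight_single] using h) _

theorem mul_mem_weightLT {w : σ → ℕ} {n k l : ℕ} {p q : MvPolynomial σ K}
    (hp : p ∈ weightLT K w n) (hq : q ∈ weightLT K w k) (h : n + k ≤ l + 1) :
    p * q ∈ weightLT K w l := by
  classical
  rw [mem_weightLT] at *
  intro m hm
  obtain ⟨x, hx, y, hy, rfl⟩ := Finset.mem_add.1 (support_mul p q hm)
  have := hp x hx
  have := hq y hy
  rw [map_add]
  omega

theorem mul_mem_weightLT_add {w : σ → ℕ} {n k : ℕ} {p q : MvPolynomial σ K}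
    (hp : p ∈ weightLT K w (n + 1)) (hq : q ∈ weightLT K w (k + 1)) :
    p * q ∈ weightLT K w (n + k + 1) :=
  mul_mem_weightLT hp hq (by omega)

theorem mem_of_monomial_mem_of_mem_weightLT {w : σ → ℕ} {n : ℕ} {p : MvPolynomial σ K}
    {S : Submodule K (MvPolynomial σ K)} (hp : p ∈ weightLT K w n)
    (h : ∀ m, Finsupp.weight w m < n → monomial m 1 ∈ S) : p ∈ S := by
  rw [p.as_sum]
  refine S.sum_mem fun m hm => ?_
  have := S.smul_mem (coeff m p) (h m (mem_weightLT.1 hp m hm))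
  simpa [smul_monomial] using this

theorem weight_tsub_add_lt {w e : σ → ℕ} {m n : σ →₀ ℕ} {i : σ} (hi : e i ≤ m i)
    (hn : Finsupp.weight w n < e i * w i) :
    Finsupp.weight w (m - Finsupp.single i (e i) + n) < Finsupp.weight w m := by
  have h : m - Finsupp.single i (e i) + Finsupp.single i (e i) = m :=
    tsub_add_cancel_of_le (Finsupp.single_le_iff.2 hi)
  have h2 := congrArg (Finsupp.weight w) h
  rw [map_add, Finsupp.weight_single, smul_eq_mul] at h2
  rw [map_add]
  omega

open Classical in
/-- The value on a monomial of the functional on `K[X]/(Xᵢ ^ eᵢ - rᵢ)` that takes the values `v`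
on the monomials with all exponents less than `e`. -/
noncomputable def boxFunctionalCoeff {w e : σ → ℕ} {r : σ → MvPolynomial σ K}
    (hr : ∀ i, r i ∈ weightLT K w (e i * w i)) (v : (σ →₀ ℕ) → K) (m : σ →₀ ℕ) : K :=
  if h : ∃ i, e i ≤ m i then
    ∑ n ∈ (r h.choose).support.attach, coeff n.1 (r h.choose) *
      boxFunctionalCoeff hr v (m - Finsupp.single h.choose (e h.choose) + n.1)
  else v m
termination_by Finsupp.weight w m
decreasing_by exact weight_tsub_add_lt h.choose_spec (mem_weightLT.1 (hr _) _ n.2)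

/-- If each `rᵢ` has weight less than `Xᵢ ^ eᵢ`, then a functional on `K[X]/(Xᵢ ^ eᵢ - rᵢ)` can be
prescribed on the monomials with all exponents less than `e`. -/
theorem exists_functional_of_mem_weightLT {w e : σ → ℕ} {r : σ → MvPolynomial σ K}
    (hr : ∀ i, r i ∈ weightLT K w (e i * w i)) (v : (σ →₀ ℕ) → K) :
    ∃ Λ : MvPolynomial σ K →ₗ[K] K, (∀ i p, Λ (p * (X i ^ e i - r i)) = 0) ∧
      ∀ m, (∀ i, m i < e i) → Λ (monomial m 1) = v m := by
  classical
  let Λ : MvPolynomial σ K →ₗ[K] K := (basisMonomials σ K).constr K (boxFunctionalCoeff hr v)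
  have hΛ (m) : Λ (monomial m 1) = boxFunctionalCoeff hr v m := by
    simpa using (basisMonomials σ K).constr_basis K (boxFunctionalCoeff hr v) m
  have hmul (m : σ →₀ ℕ) (q : MvPolynomial σ K) :
      Λ (monomial m 1 * q) = ∑ n ∈ q.support, coeff n q * Λ (monomial (m + n) 1) := by
    conv_lhs => rw [q.as_sum, Finset.mul_sum, map_sum]
    refine Finset.sum_congr rfl fun n _ => ?_
    rw [monomial_mul, one_mul, ← smul_eq_mul, ← map_smul, smul_monomial, smul_eq_mul, mul_one]
  have hchoose (m) (h : ∃ i, e i ≤ m i) : Λ (monomial m 1) =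
      Λ (monomial (m - Finsupp.single h.choose (e h.choose)) 1 * r h.choose) := by
    rw [hΛ, boxFunctionalCoeff, dif_pos h, hmul]
    simp_rw [← hΛ]
    exact Finset.sum_attach (r h.choose).support fun n => coeff n (r h.choose) *
      Λ (monomial (m - Finsupp.single h.choose (e h.choose) + n) 1)
  have key (N : ℕ) : ∀ m i, Finsupp.weight w (m + Finsupp.single i (e i)) = N →
      Λ (monomial (m + Finsupp.single i (e i)) 1) = Λ (monomial m 1 * r i) := by
    induction N using Nat.strong_induction_on with
    | _ N ih =>
      intro m i hm
      set M := m + Finsupp.single i (e i) with hM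
      have h : ∃ i, e i ≤ M i := ⟨i, by simp [hM]⟩
      rw [hchoose M h]
      obtain ⟨j, hj, hjM⟩ : ∃ j, j = h.choose ∧ e j ≤ M j := ⟨_, rfl, h.choose_spec⟩
      rw [← hj]
      by_cases hij : j = i
      · subst hij
        rw [hM, add_tsub_cancel_right]
      have hjm : Finsupp.single j (e j) ≤ m := by
        rw [Finsupp.single_le_iff]
        simpa [hM, Finsupp.single_apply, Ne.symm hij] using hjM
      obtain ⟨k, rfl⟩ := exists_add_of_le hjm
      have swap (i' j') (q) (hq : q ∈ weightLT K w (e j' * w j'))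
          (hw : Finsupp.weight w (k + Finsupp.single j' (e j') + Finsupp.single i' (e i')) = N) :
          Λ (monomial (k + Finsupp.single i' (e i')) 1 * q) = Λ (monomial k 1 * (q * r i')) := by
        rw [hmul, mul_comm q, ← mul_assoc, mul_comm _ q]
        conv_rhs => rw [q.as_sum, Finset.sum_mul, map_sum]
        refine Finset.sum_congr rfl fun n hn => ?_
        rw [add_right_comm, ih _ ?_ _ _ rfl, ← smul_eq_mul, ← map_smul]
        · congr 1
          rw [← mul_assoc, monomial_mul, ← smul_mul_assoc, smul_monomial, add_comm k n]
          simp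
        · have := mem_weightLT.1 hq n hn
          simp only [map_add, Finsupp.weight_single, smul_eq_mul] at hw ⊢
          omega
      have e1 : M - Finsupp.single j (e j) = k + Finsupp.single i (e i) := by
        rw [hM, add_assoc, add_tsub_cancel_left]
      rw [e1, swap i j (r j) (hr j) (by rw [← hm, add_comm k]),
        add_comm (Finsupp.single j (e j)) k,
        swap j i (r i) (hr i) (by rw [← hm, add_right_comm, add_comm k]), mul_comm (r i)]
  refine ⟨Λ, fun i p => ?_, fun m hm => ?_⟩
  · induction p using MvPolynomial.induction_on' with
    | monomial m c =>
      have : monomial m c = c • (monomial m 1 : MvPolynomial σ K) := by simp [smul_monomial]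
      rw [this, smul_mul_assoc, map_smul, mul_sub, map_sub, ← key _ m i rfl, X_pow_eq_monomial,
        monomial_mul, one_mul, sub_self, smul_zero]
    | add p q hp hq => rw [add_mul, map_add, hp, hq, add_zero]
  · rw [hΛ, boxFunctionalCoeff, dif_neg (by simpa using hm)]

/-- A functional as in `exists_functional_of_mem_weightLT` vanishes on polynomials of small weight
as soon as it does so on monomials with all exponents less than `e`. -/
theorem functional_eq_zero_of_mem_weightLT {w e : σ → ℕ} {r : σ → MvPolynomial σ K}
    (hr : ∀ i, r i ∈ weightLT K w (e i * w i)) {Λ : MvPolynomial σ K →ₗ[K] K}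
    (hΛ : ∀ i p, Λ (p * (X i ^ e i - r i)) = 0) {n : ℕ}
    (hn : ∀ m, (∀ i, m i < e i) → Finsupp.weight w m < n → Λ (monomial m 1) = 0)
    {p : MvPolynomial σ K} (hp : p ∈ weightLT K w n) : Λ p = 0 := by
  suffices h : ∀ N, ∀ m, Finsupp.weight w m = N → N < n → monomial m 1 ∈ LinearMap.ker Λ from
    mem_of_monomial_mem_of_mem_weightLT hp fun m hm => h _ m rfl hm
  intro N
  induction N using Nat.strong_induction_on with
  | _ N ih =>
    intro m hm hN
    by_cases hbox : ∀ i, m i < e i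
    · exact hn m hbox (hm ▸ hN)
    push Not at hbox
    obtain ⟨i, hi⟩ := hbox
    obtain ⟨k, rfl⟩ := exists_add_of_le (Finsupp.single_le_iff.2 hi)
    have hk : (monomial (Finsupp.single i (e i) + k) 1 : MvPolynomial σ K) =
        monomial k 1 * (X i ^ e i - r i) + monomial k 1 * r i := by
      rw [← mul_add, sub_add_cancel, X_pow_eq_monomial, monomial_mul, add_comm, one_mul]
    rw [hk]
    refine Submodule.add_mem _ (hΛ i _) ?_
    refine mem_of_monomial_mem_of_mem_weightLT
      (mul_mem_weightLT (monomial_mem_weightLT (Nat.lt_succ_self _) 1) (hr i) (l := N) ?_)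
      fun m' hm' => ih _ hm' m' rfl (hm'.trans hN)
    simp only [map_add, Finsupp.weight_single, smul_eq_mul] at hm
    omega

end Weights

section Cusp

variable {K : Type*} [Field K]

/-- The polynomial `Σ_{j ≤ dᵢ} q_{i,j} xᵢʲ` in the variable `xᵢ`. -/
noncomputable def branchPoly (d : Fin 3 → ℕ) (q : Fin 3 → ℕ → K) (i : Fin 3) :
    MvPolynomial (Fin 3) K :=
  ∑ j ∈ Finset.range (d i + 1), C (q i j) * X i ^ j

/-- The ideal `(x₂x₃ - Q₁(x₁), x₁x₃ - Q₂(x₂), x₁x₂ - Q₃(x₃))`. -/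
noncomputable def cuspIdeal (d : Fin 3 → ℕ) (q : Fin 3 → ℕ → K) :
    Ideal (MvPolynomial (Fin 3) K) :=
  Ideal.span (Set.range fun i => X (i + 1) * X (i + 2) - branchPoly d q i)

variable {d : Fin 3 → ℕ} {q : Fin 3 → ℕ → K} {w : Fin 3 → ℕ} {N : ℕ}

theorem C_mul_mem_weightLT {n : ℕ} (c : K) {p : MvPolynomial (Fin 3) K}
    (hp : p ∈ weightLT K w n) : C c * p ∈ weightLT K w n := by
  rw [C_mul']
  exact Submodule.smul_mem _ _ hp

theorem exists_branchPoly_eq (hw0 : ∀ i, 0 < w i) (i : Fin 3) :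
    ∃ t ∈ weightLT K w (d i * w i), branchPoly d q i = C (q i (d i)) * X i ^ d i + t := by
  refine ⟨∑ j ∈ Finset.range (d i), C (q i j) * X i ^ j, Submodule.sum_mem _ fun j hj => ?_, ?_⟩
  · exact C_mul_mem_weightLT _ (X_pow_mem_weightLT
      (Nat.mul_lt_mul_of_pos_right (Finset.mem_range.1 hj) (hw0 i)))
  · rw [branchPoly, Finset.sum_range_succ, add_comm]

theorem branchPoly_mem_weightLT (i : Fin 3) :
    branchPoly d q i ∈ weightLT K w (d i * w i + 1) :=
  Submodule.sum_mem _ fun _ hj => C_mul_mem_weightLT _ (X_pow_mem_weightLT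
    (Nat.lt_succ_of_le (Nat.mul_le_mul_right _ (Nat.lt_succ_iff.1 (Finset.mem_range.1 hj)))))

theorem X_mul_X_sub_branchPoly_mem {i j k : Fin 3} (hij : i ≠ j) (hik : i ≠ k) (hjk : j ≠ k) :
    X j * X k - branchPoly d q i ∈ cuspIdeal d q := by
  have h : X (i + 1) * X (i + 2) - branchPoly d q i ∈ cuspIdeal d q :=
    Ideal.subset_span ⟨i, rfl⟩
  obtain ⟨rfl, rfl⟩ | ⟨rfl, rfl⟩ : j = i + 1 ∧ k = i + 2 ∨ j = i + 2 ∧ k = i + 1 := by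
    clear h; revert i j k; decide
  · exact h
  · rwa [mul_comm]

theorem ne_succ_succ (i : Fin 3) : i ≠ i + 1 ∧ i ≠ i + 2 ∧ i + 1 ≠ i + 2 := by
  revert i; decide

theorem exists_distinct {i j : Fin 3} (h : i ≠ j) : ∃ k, i ≠ k ∧ j ≠ k := by
  revert i j; decide

theorem X_mul_branchPoly_sub_mem {i j : Fin 3} (hij : i ≠ j) :
    X i * branchPoly d q i - X j * branchPoly d q j ∈ cuspIdeal d q := by
  obtain ⟨k, hik, hjk⟩ := exists_distinct hij
  have h := sub_mem
    (Ideal.mul_mem_left _ (X j) (X_mul_X_sub_branchPoly_mem (d := d) (q := q) hij.symm hjk hik))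
    (Ideal.mul_mem_left _ (X i) (X_mul_X_sub_branchPoly_mem (d := d) (q := q) hij hik hjk))
  convert h using 1
  ring

theorem X_sq_mul_branchPoly_sub_mem {i j k : Fin 3} (hij : i ≠ j) (hik : i ≠ k) (hjk : j ≠ k) :
    X i ^ 2 * branchPoly d q i - branchPoly d q j * branchPoly d q k ∈ cuspIdeal d q := by
  have h1 := X_mul_X_sub_branchPoly_mem (d := d) (q := q) hij hik hjk
  have h2 := X_mul_X_sub_branchPoly_mem (d := d) (q := q) hij.symm hjk hik
  have h3 := X_mul_X_sub_branchPoly_mem (d := d) (q := q) hik.symm hjk.symm hij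
  have h := add_mem (sub_mem (Ideal.mul_mem_left _ (X i * X j) h2)
    (Ideal.mul_mem_left _ (X i ^ 2) h1)) (Ideal.mul_mem_left _ (branchPoly d q j) h3)
  convert h using 1
  ring

theorem mem_of_C_mul_mem {S : Submodule K (MvPolynomial (Fin 3) K)} {c : K} (hc : c ≠ 0)
    {p : MvPolynomial (Fin 3) K} (h : C c * p ∈ S) : p ∈ S := by
  rwa [C_mul', S.smul_mem_iff hc] at h

theorem eq_single_or_exists_ne {σ : Type*} [Nonempty σ] (m : σ →₀ ℕ) :
    (∃ i k, m = Finsupp.single i k) ∨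
      ∃ i j m', i ≠ j ∧ m = Finsupp.single i 1 + Finsupp.single j 1 + m' := by
  classical
  by_cases hm : m = 0
  · exact .inl ⟨Classical.arbitrary σ, 0, by simp [hm]⟩
  obtain ⟨i, hi⟩ := Finsupp.ne_iff.1 hm
  by_cases h : ∃ j, i ≠ j ∧ m j ≠ 0
  · obtain ⟨j, hij, hj⟩ := h
    refine .inr ⟨i, j, m - (Finsupp.single i 1 + Finsupp.single j 1), hij, ?_⟩
    refine (add_tsub_cancel_of_le fun l => ?_).symm
    simp only [Finsupp.coe_add, Pi.add_apply, Finsupp.single_apply, Finsupp.coe_zero,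
      Pi.zero_apply] at hi ⊢
    split_ifs with h1 h2 h2
    · exact absurd (h1.trans h2.symm) hij
    · subst h1; omega
    · subst h2; omega
    · omega
  · push Not at h
    refine .inl ⟨i, m i, Finsupp.ext fun j => ?_⟩
    by_cases hij : i = j
    · simp [hij]
    · simp [hij, h j hij]

/-- Pure powers up to `xᵢ ^ dᵢ`, together with `x₀ ^ (d₀ + 1)`, span everything modulo the
cusp ideal. -/
theorem eq_top_of_cuspIdeal_le (hq : ∀ i, q i (d i) ≠ 0) (hw0 : ∀ i, 0 < w i)
    (hw : ∀ i, d i * w i + w i = N) (hN : ∀ i j k, i ≠ j → i ≠ k → j ≠ k → N < w i + w j + w k)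
    {S : Submodule K (MvPolynomial (Fin 3) K)} (hI : (cuspIdeal d q).restrictScalars K ≤ S)
    (hX : ∀ i, ∀ k ≤ d i, X i ^ k ∈ S) (hX0 : X 0 ^ (d 0 + 1) ∈ S) : S = ⊤ := by
  have key (n : ℕ) : ∀ m, Finsupp.weight w m = n → monomial m 1 ∈ S := by
    induction n using Nat.strong_induction_on with
    | _ n ih =>
    intro m hm
    have low {p} (hp : p ∈ weightLT K w n) : p ∈ S :=
      mem_of_monomial_mem_of_mem_weightLT hp fun m' hm' => ih _ hm' m' rfl
    obtain ⟨i, k, rfl⟩ | ⟨i, j, m', hij, rfl⟩ := eq_single_or_exists_ne m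
    · rw [Finsupp.weight_single, smul_eq_mul] at hm
      rw [← X_pow_eq_monomial]
      obtain ⟨t, ht, hQ⟩ := exists_branchPoly_eq (d := d) (q := q) hw0 i
      rcases Nat.lt_trichotomy k (d i + 1) with hk | rfl | hk
      · exact hX i k (Nat.lt_succ_iff.1 hk)
      · by_cases hi : i = 0
        · exact hi ▸ hX0
        obtain ⟨t0, ht0, hQ0⟩ := exists_branchPoly_eq (d := d) (q := q) hw0 0
        refine mem_of_C_mul_mem (hq i) ?_
        have e : C (q i (d i)) * X i ^ (d i + 1) =
            (X i * branchPoly d q i - X 0 * branchPoly d q 0) +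
              (C (q 0 (d 0)) * X 0 ^ (d 0 + 1) + (X 0 ^ 1 * t0 - X i ^ 1 * t)) := by
          rw [hQ, hQ0]; ring
        rw [add_mul, one_mul, hw] at hm
        have := hw i
        have := hw 0
        rw [e]
        refine add_mem (hI (X_mul_branchPoly_sub_mem hi)) (add_mem ?_ (low (sub_mem ?_ ?_)))
        · rw [C_mul']
          exact S.smul_mem _ hX0
        · exact mul_mem_weightLT (X_pow_mem_weightLT (Nat.lt_succ_self _)) ht0 (by omega)
        · exact mul_mem_weightLT (X_pow_mem_weightLT (Nat.lt_succ_self _)) ht (by omega)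
      · obtain ⟨l, rfl⟩ := Nat.exists_eq_add_of_lt hk
        obtain ⟨j, k, hij, hik, hjk⟩ : ∃ j k, i ≠ j ∧ i ≠ k ∧ j ≠ k :=
          ⟨_, _, ne_succ_succ i⟩
        refine mem_of_C_mul_mem (hq i) ?_
        have e : C (q i (d i)) * X i ^ (d i + 1 + l + 1) =
            X i ^ l * (X i ^ 2 * branchPoly d q i - branchPoly d q j * branchPoly d q k) +
              (X i ^ l * (branchPoly d q j * branchPoly d q k) - X i ^ (l + 2) * t) := by
          rw [hQ]; ring
        have e2 : n = l * w i + d i * w i + 2 * w i := by rw [← hm]; ring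
        have := hw i
        have := hw j
        have := hw k
        have := hN i j k hij hik hjk
        rw [e]
        refine add_mem (hI (Ideal.mul_mem_left _ _ (X_sq_mul_branchPoly_sub_mem hij hik hjk)))
          (low (sub_mem ?_ ?_))
        · refine mul_mem_weightLT (X_pow_mem_weightLT (Nat.lt_succ_self _))
            (mul_mem_weightLT_add (branchPoly_mem_weightLT j) (branchPoly_mem_weightLT k)) ?_
          omega
        · refine mul_mem_weightLT (X_pow_mem_weightLT (Nat.lt_succ_self _)) ht ?_
          rw [add_mul]
          omega
    · obtain ⟨k, hik, hjk⟩ := exists_distinct hij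
      have e : (monomial (Finsupp.single i 1 + Finsupp.single j 1 + m') 1 :
          MvPolynomial (Fin 3) K) = monomial m' 1 * (X i * X j - branchPoly d q k) +
            monomial m' 1 * branchPoly d q k := by
        rw [← mul_add, sub_add_cancel, X, X, monomial_mul, monomial_mul, add_comm m']
        simp
      have := hw k
      have := hN i j k hij hik hjk
      simp only [map_add, Finsupp.weight_single, smul_eq_mul, one_mul] at hm
      rw [e]
      refine add_mem (hI (Ideal.mul_mem_left _ _
        (X_mul_X_sub_branchPoly_mem hik.symm hjk.symm hij))) (low ?_)
      exact mul_mem_weightLT (monomial_mem_weightLT (Nat.lt_succ_self _) 1)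
        (branchPoly_mem_weightLT k) (by omega)
  rw [eq_top_iff]
  intro p _
  exact mem_of_monomial_mem_of_mem_weightLT (w := w) (n := p.support.sup (Finsupp.weight w) + 1)
    (mem_weightLT.2 fun m hm => Nat.lt_succ_of_le (Finset.le_sup hm)) fun m _ => key _ m rfl

/-- Up to sign, and modulo the elements `xᵢ²Qᵢ - QⱼQₖ` of the cusp ideal, the determinant of a
matrix expressing these elements through the generators of the cusp ideal. -/
noncomputable def transitionDet (d : Fin 3 → ℕ) (q : Fin 3 → ℕ → K) :
    MvPolynomial (Fin 3) K :=
  X 1 * X 2 * branchPoly d q 1 * branchPoly d q 2 +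
    X 0 * X 2 * branchPoly d q 0 * branchPoly d q 2 +
    X 0 * X 1 * branchPoly d q 0 * branchPoly d q 1 +
    branchPoly d q 0 * branchPoly d q 1 * branchPoly d q 2

theorem transitionDet_eq {i j k : Fin 3} (hij : i ≠ j) (hik : i ≠ k) (hjk : j ≠ k) :
    transitionDet d q = X j * X k * branchPoly d q j * branchPoly d q k +
      X i * X k * branchPoly d q i * branchPoly d q k +
      X i * X j * branchPoly d q i * branchPoly d q j +
      branchPoly d q i * branchPoly d q j * branchPoly d q k := by
  have h : i = 0 ∧ j = 1 ∧ k = 2 ∨ i = 0 ∧ j = 2 ∧ k = 1 ∨ i = 1 ∧ j = 0 ∧ k = 2 ∨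
      i = 1 ∧ j = 2 ∧ k = 0 ∨ i = 2 ∧ j = 0 ∧ k = 1 ∨ i = 2 ∧ j = 1 ∧ k = 0 := by
    revert i j k; decide
  obtain ⟨rfl, rfl, rfl⟩ | ⟨rfl, rfl, rfl⟩ | ⟨rfl, rfl, rfl⟩ | ⟨rfl, rfl, rfl⟩ |
    ⟨rfl, rfl, rfl⟩ | ⟨rfl, rfl, rfl⟩ := h <;> rw [transitionDet] <;> ring

/-- A functional on the quotient by the cusp ideal (a multiple of the residue) that vanishes in
weight less than `N`, but not on the monomials `xᵢ ^ (dᵢ + 1)` of weight `N`. -/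
theorem exists_residue_functional (hq : ∀ i, q i (d i) ≠ 0) (hw0 : ∀ i, 0 < w i)
    (hw : ∀ i, d i * w i + w i = N)
    (hN : ∀ i j k, i ≠ j → i ≠ k → j ≠ k → N < w i + w j + w k) :
    ∃ l : MvPolynomial (Fin 3) K →ₗ[K] K, (∀ p ∈ cuspIdeal d q, l p = 0) ∧
      (∀ p ∈ weightLT K w N, l p = 0) ∧ ∀ i, l (X i ^ (d i + 1)) ≠ 0 := by
  classical
  have hw1 (i) : (d i + 1) * w i = N := by rw [add_mul, one_mul, hw]
  let F (i : Fin 3) : MvPolynomial (Fin 3) K :=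
    X i ^ 2 * branchPoly d q i - branchPoly d q (i + 1) * branchPoly d q (i + 2)
  let r (i : Fin 3) : MvPolynomial (Fin 3) K := X i ^ (d i + 2) - C (q i (d i))⁻¹ * F i
  have hr (i) : r i ∈ weightLT K w ((d i + 2) * w i) := by
    obtain ⟨t, ht, hQ⟩ := exists_branchPoly_eq (d := d) (q := q) hw0 i
    have hC : (C (q i (d i))⁻¹ * C (q i (d i)) : MvPolynomial (Fin 3) K) = 1 := by
      rw [← C_mul, inv_mul_cancel₀ (hq i), C_1]
    have e : r i = C (q i (d i))⁻¹ *
        (branchPoly d q (i + 1) * branchPoly d q (i + 2) - X i ^ 2 * t) := by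
      simp only [r, F, hQ]
      linear_combination (-X i ^ (d i + 2)) * hC
    obtain ⟨hij, hik, hjk⟩ := ne_succ_succ i
    have := hw i
    have := hw (i + 1)
    have := hw (i + 2)
    have := hN _ _ _ hij hik hjk
    rw [e, add_mul]
    refine C_mul_mem_weightLT _ (sub_mem ?_ ?_)
    · exact mul_mem_weightLT (branchPoly_mem_weightLT _) (branchPoly_mem_weightLT _) (by omega)
    · exact mul_mem_weightLT (X_pow_mem_weightLT (Nat.lt_succ_self _)) ht (by omega)
  let top : Fin 3 →₀ ℕ := Finsupp.equivFunOnFinite.symm fun i => d i + 1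
  have htop : Finsupp.weight w top = 3 * N := by
    rw [Finsupp.weight_eq_sum, Fin.sum_univ_three]
    simp only [top, Finsupp.equivFunOnFinite_symm_apply_apply, smul_eq_mul, hw1]
    ring
  obtain ⟨Λ, hΛF, hΛv⟩ := exists_functional_of_mem_weightLT (w := w) (e := fun i => d i + 2) hr
    fun m => if m = top then 1 else 0
  have hΛN {p} (hp : p ∈ weightLT K w (3 * N)) : Λ p = 0 := by
    refine functional_eq_zero_of_mem_weightLT (w := w) (e := fun i => d i + 2) hr hΛF
      (fun m hm hmN => ?_) hp
    rw [hΛv m hm, if_neg]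
    rintro rfl
    exact hmN.ne htop
  have hΛ (i p) : Λ (p * F i) = 0 := by
    have := hΛF i (p * C (q i (d i)))
    rwa [show p * C (q i (d i)) * (X i ^ (d i + 2) - r i) =
      p * F i * (C (q i (d i)) * C (q i (d i))⁻¹) by simp only [r]; ring, ← C_mul,
      mul_inv_cancel₀ (hq i), C_1, mul_one] at this
  have hF {i j k : Fin 3} (hij : i ≠ j) (hik : i ≠ k) (hjk : j ≠ k) : F i =
      X i ^ 2 * branchPoly d q i - branchPoly d q j * branchPoly d q k := by
    obtain ⟨rfl, rfl⟩ | ⟨rfl, rfl⟩ : j = i + 1 ∧ k = i + 2 ∨ j = i + 2 ∧ k = i + 1 := by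
      revert i j k; decide
    · rfl
    · simp only [F]; ring
  refine ⟨Λ ∘ₗ LinearMap.mulLeft K (transitionDet d q), fun p hp => ?_, fun p hp => ?_,
    fun i => ?_⟩
  · rw [LinearMap.comp_apply, LinearMap.mulLeft_apply]
    obtain ⟨c, rfl⟩ := Ideal.mem_span_range_iff_exists_fun.1 hp
    rw [Finset.mul_sum, map_sum]
    refine Finset.sum_eq_zero fun i _ => ?_
    obtain ⟨hij, hik, hjk⟩ := ne_succ_succ i
    generalize i + 1 = j at *
    generalize i + 2 = k at *
    have e : transitionDet d q * (c i * (X j * X k - branchPoly d q i)) =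
        (c i * (X k ^ 2 * branchPoly d q k + X i * X k * branchPoly d q i)) * F j +
        (c i * (branchPoly d q i * branchPoly d q k + X i * X j * branchPoly d q i)) * F k := by
      rw [transitionDet_eq hij hik hjk, hF hij.symm hjk hik, hF hik.symm hjk.symm hij]
      ring
    rw [e, map_add, hΛ, hΛ, add_zero]
  · have hD : transitionDet d q ∈ weightLT K w (2 * N + 1) := by
      have h (i j : Fin 3) : X i ^ 1 * X j ^ 1 * branchPoly d q i * branchPoly d q j ∈
          weightLT K w (2 * N + 1) := by
        have := hw i
        have := hw j
        exact mul_mem_weightLT (mul_mem_weightLT_add (mul_mem_weightLT_add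
          (X_pow_mem_weightLT (Nat.lt_succ_self _)) (X_pow_mem_weightLT (Nat.lt_succ_self _)))
          (branchPoly_mem_weightLT i)) (branchPoly_mem_weightLT j) (by omega)
      have := hw 0
      have := hw 1
      have := hw 2
      have := hN 0 1 2 (by decide) (by decide) (by decide)
      simp only [pow_one] at h
      exact add_mem (add_mem (add_mem (h 1 2) (h 0 2)) (h 0 1)) (mul_mem_weightLT
        (mul_mem_weightLT_add (branchPoly_mem_weightLT 0) (branchPoly_mem_weightLT 1))
        (branchPoly_mem_weightLT 2) (by omega))
    exact hΛN (mul_mem_weightLT hD hp (by omega))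
  · obtain ⟨hij, hik, hjk⟩ := ne_succ_succ i
    have htopX : (X i ^ (d i + 1) * X (i + 1) ^ (d (i + 1) + 1) * X (i + 2) ^ (d (i + 2) + 1) :
        MvPolynomial (Fin 3) K) = monomial top 1 := by
      rw [X_pow_eq_monomial, X_pow_eq_monomial, X_pow_eq_monomial, monomial_mul, monomial_mul,
        one_mul, one_mul]
      refine congrArg (fun m => monomial m 1) (Finsupp.ext fun l => ?_)
      fin_cases i <;> fin_cases l <;> simp [top]
    generalize i + 1 = j at *
    generalize i + 2 = k at *
    obtain ⟨t, ht, hQj⟩ := exists_branchPoly_eq (d := d) (q := q) hw0 j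
    obtain ⟨u, hu, hQk⟩ := exists_branchPoly_eq (d := d) (q := q) hw0 k
    have hi := hw i
    have hj := hw j
    have hk := hw k
    have hijk := hN i j k hij hik hjk
    set A := branchPoly d q i with hA
    set B := branchPoly d q j with hB
    set Q := branchPoly d q k with hQ
    have hAm : A ∈ weightLT K w (d i * w i + 1) := branchPoly_mem_weightLT i
    have hBm : B ∈ weightLT K w (d j * w j + 1) := branchPoly_mem_weightLT j
    have hQm : Q ∈ weightLT K w (d k * w k + 1) := branchPoly_mem_weightLT k
    have hX (l : Fin 3) (n : ℕ) : (X l ^ n : MvPolynomial (Fin 3) K) ∈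
      weightLT K w (n * w l + 1) := X_pow_mem_weightLT (Nat.lt_succ_self _)
    have e : transitionDet d q * X i ^ (d i + 1) =
        C (q j (d j) * q k (d k)) *
          (X i ^ (d i + 1) * X j ^ (d j + 1) * X k ^ (d k + 1)) +
        (X i ^ d i * X k * Q + X i ^ d i * X j * B) * F i +
        (X i ^ (d i + 1) * X j ^ 1 * X k ^ 1 * B * u +
          X i ^ (d i + 1) * X j ^ 1 * X k ^ (d k + 1) * C (q k (d k)) * t +
          X i ^ d i * X k ^ 1 * B * Q * Q + X i ^ d i * X j ^ 1 * B * B * Q +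
          X i ^ (d i + 1) * A * B * Q) := by
      rw [transitionDet_eq hij hik hjk, hF hij hik hjk, ← hA, ← hB, ← hQ, C_mul]
      have h1 := hQj
      have h2 := hQk
      linear_combination (X i ^ (d i + 1) * X j * X k * B) * h2 +
        (X i ^ (d i + 1) * X j * X k * C (q k (d k)) * X k ^ d k) * h1
    have hlow : X i ^ (d i + 1) * X j ^ 1 * X k ^ 1 * B * u +
          X i ^ (d i + 1) * X j ^ 1 * X k ^ (d k + 1) * C (q k (d k)) * t +
          X i ^ d i * X k ^ 1 * B * Q * Q + X i ^ d i * X j ^ 1 * B * B * Q +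
          X i ^ (d i + 1) * A * B * Q ∈ weightLT K w (3 * N) := by
      have hi1 := hw1 i
      have hk1 := hw1 k
      refine add_mem (add_mem (add_mem (add_mem ?_ ?_) ?_) ?_) ?_
      · exact mul_mem_weightLT (mul_mem_weightLT_add (mul_mem_weightLT_add (mul_mem_weightLT_add
          (hX _ _) (hX _ _)) (hX _ _)) hBm) hu (by omega)
      · rw [mul_assoc _ (C _)]
        exact mul_mem_weightLT (mul_mem_weightLT_add (mul_mem_weightLT_add
          (hX _ _) (hX _ _)) (hX _ _)) (C_mul_mem_weightLT _ ht) (by omega)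
      · exact mul_mem_weightLT (mul_mem_weightLT_add (mul_mem_weightLT_add (mul_mem_weightLT_add
          (hX _ _) (hX _ _)) hBm) hQm) hQm (by omega)
      · exact mul_mem_weightLT (mul_mem_weightLT_add (mul_mem_weightLT_add (mul_mem_weightLT_add
          (hX _ _) (hX _ _)) hBm) hBm) hQm (by omega)
      · exact mul_mem_weightLT (mul_mem_weightLT_add (mul_mem_weightLT_add
          (hX _ _) hAm) hBm) hQm (by omega)
    rw [LinearMap.comp_apply, LinearMap.mulLeft_apply, e, map_add, map_add, hΛ, hΛN hlow, htopX,
      C_mul', map_smul, hΛv top fun i => by simp [top], if_pos rfl]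
    simpa using ⟨hq j, hq k⟩

/-- The variable occurring in an element of the monomial basis of the quotient by the cusp
ideal. -/
def basisVar (d : Fin 3 → ℕ) : Fin (d 0 + 2) ⊕ Fin (d 1) ⊕ Fin (d 2) → Fin 3 :=
  Sum.elim (fun _ => 0) (Sum.elim (fun _ => 1) fun _ => 2)

/-- The exponent of the variable in an element of the monomial basis of the quotient by the cusp
ideal. -/
def basisExp (d : Fin 3 → ℕ) : Fin (d 0 + 2) ⊕ Fin (d 1) ⊕ Fin (d 2) → ℕ :=
  Sum.elim (fun k => k) (Sum.elim (fun k => k + 1) fun k => k + 1)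

/-- The monomials `xᵢ ^ k`, `k ≤ dᵢ`, and `x₀ ^ (d₀ + 1)`. -/
noncomputable def basisMonomial (K : Type*) [Field K] (d : Fin 3 → ℕ)
    (s : Fin (d 0 + 2) ⊕ Fin (d 1) ⊕ Fin (d 2)) : MvPolynomial (Fin 3) K :=
  X (basisVar d s) ^ basisExp d s

theorem basisExp_le (s : Fin (d 0 + 2) ⊕ Fin (d 1) ⊕ Fin (d 2)) :
    basisExp d s ≤ d (basisVar d s) + 1 := by
  rcases s with s | s | s <;> simp only [basisExp, basisVar, Sum.elim_inl, Sum.elim_inr] <;> omega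

theorem basisVar_eq_zero {s : Fin (d 0 + 2) ⊕ Fin (d 1) ⊕ Fin (d 2)}
    (h : basisExp d s = 0 ∨ basisExp d s = d (basisVar d s) + 1) : basisVar d s = 0 := by
  rcases s with s | s | s <;>
    simp only [basisExp, basisVar, Sum.elim_inl, Sum.elim_inr] at h ⊢ <;> omega

theorem eq_of_basisVar_eq {s t : Fin (d 0 + 2) ⊕ Fin (d 1) ⊕ Fin (d 2)}
    (h : basisVar d s = basisVar d t) (h' : basisExp d s = basisExp d t) : s = t := by
  rcases s with s | s | s <;> rcases t with t | t | t <;>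
    simp_all [basisExp, basisVar, Fin.ext_iff]

theorem exists_basisMonomial_eq {i : Fin 3} {k : ℕ} (hk : k ≤ d i) :
    ∃ s, basisMonomial K d s = X i ^ k := by
  rcases k with _ | k
  · exact ⟨.inl 0, by simp [basisMonomial, basisExp]⟩
  obtain rfl | rfl | rfl : i = 0 ∨ i = 1 ∨ i = 2 := by clear hk; revert i; decide
  · exact ⟨.inl ⟨k + 1, by omega⟩, rfl⟩
  · exact ⟨.inr (.inl ⟨k, by omega⟩), rfl⟩
  · exact ⟨.inr (.inr ⟨k, by omega⟩), rfl⟩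

/-- Triangularity of the residue pairing on the monomial basis. -/
theorem residue_basisMonomial_mul_eq_zero (hw0 : ∀ i, 0 < w i)
    (hw : ∀ i, d i * w i + w i = N) (hN : ∀ i j k, i ≠ j → i ≠ k → j ≠ k → N < w i + w j + w k)
    {l : MvPolynomial (Fin 3) K →ₗ[K] K} (hlI : ∀ p ∈ cuspIdeal d q, l p = 0)
    (hlN : ∀ p ∈ weightLT K w N, l p = 0)
    {s t : Fin (d 0 + 2) ⊕ Fin (d 1) ⊕ Fin (d 2)} (hst : s ≠ t)
    (hle : basisExp d s * w (basisVar d s) ≤ basisExp d t * w (basisVar d t)) :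
    l (basisMonomial K d s * X (basisVar d t) ^ (d (basisVar d t) + 1 - basisExp d t)) = 0 := by
  have hs := basisExp_le s
  have ht := basisExp_le t
  have hs0 := basisVar_eq_zero (s := s)
  have ht0 := basisVar_eq_zero (s := t)
  have hvar := eq_of_basisVar_eq (s := s) (t := t)
  rw [basisMonomial]
  generalize basisVar d s = i at *
  generalize basisVar d t = j at *
  generalize basisExp d s = m at *
  obtain ⟨n, hn⟩ := exists_add_of_le ht
  rw [hn, add_tsub_cancel_left]
  generalize basisExp d t = k at *
  have hw1 : k * w j + n * w j = N := by rw [← add_mul, ← hn, add_mul, one_mul, hw]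
  have lt (h : m * w i + n * w j < N) : l (X i ^ m * X j ^ n) = 0 :=
    hlN _ (mul_mem_weightLT (X_pow_mem_weightLT (Nat.lt_succ_self _))
      (X_pow_mem_weightLT (Nat.lt_succ_self _)) (by omega))
  by_cases hij : i = j
  · subst hij
    refine lt ?_
    have : m ≠ k := fun h => hst (hvar rfl h)
    have : m * w i ≠ k * w i := fun h => this (Nat.eq_of_mul_eq_mul_right (hw0 i) h)
    omega
  rcases m with _ | m
  · have hk : 0 < k := Nat.pos_of_ne_zero fun h => hij ((hs0 (.inl rfl)).trans (ht0 (.inl h)).symm)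
    have := Nat.mul_pos hk (hw0 j)
    exact lt (by omega)
  rcases n with _ | n
  · have hm : m + 1 ≤ d i := by
      by_contra h
      exact hij ((hs0 (.inr (by omega))).trans (ht0 (.inr (by omega))).symm)
    have h1 := Nat.mul_le_mul_right (w i) hm
    have := hw i
    have := hw0 i
    exact lt (by omega)
  obtain ⟨p, hip, hjp⟩ := exists_distinct hij
  have e : (X i ^ (m + 1) * X j ^ (n + 1) : MvPolynomial (Fin 3) K) =
      X i ^ m * X j ^ n * (X i * X j - branchPoly d q p) +
        X i ^ m * X j ^ n * branchPoly d q p := by ring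
  rw [e, map_add, hlI _ (Ideal.mul_mem_left _ _
    (X_mul_X_sub_branchPoly_mem hip.symm hjp.symm hij)), zero_add]
  refine hlN _ (mul_mem_weightLT (mul_mem_weightLT_add (X_pow_mem_weightLT (Nat.lt_succ_self _))
    (X_pow_mem_weightLT (Nat.lt_succ_self _))) (branchPoly_mem_weightLT p) ?_)
  have := hw p
  have := hN i j p hij hip hjp
  rw [add_mul, one_mul] at hle hw1
  omega

theorem linearIndependent_basisMonomial (hq : ∀ i, q i (d i) ≠ 0) (hw0 : ∀ i, 0 < w i)
    (hw : ∀ i, d i * w i + w i = N)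
    (hN : ∀ i j k, i ≠ j → i ≠ k → j ≠ k → N < w i + w j + w k) :
    LinearIndependent K fun s => Ideal.Quotient.mkₐ K (cuspIdeal d q) (basisMonomial K d s) := by
  classical
  obtain ⟨l, hlI, hlN, hl⟩ := exists_residue_functional hq hw0 hw hN
  rw [Fintype.linearIndependent_iff]
  intro g hg
  simp_rw [← map_smul] at hg
  rw [← map_sum, Ideal.Quotient.mkₐ_eq_mk, Ideal.Quotient.eq_zero_iff_mem] at hg
  by_contra! h
  obtain ⟨t, ht, hmax⟩ := Finset.exists_max_image (Finset.univ.filter fun s => g s ≠ 0)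
    (fun s => basisExp d s * w (basisVar d s)) (h.imp fun s hs => by simpa using hs)
  rw [Finset.mem_filter] at ht
  have h0 := hlI _ (Ideal.mul_mem_right
    (X (basisVar d t) ^ (d (basisVar d t) + 1 - basisExp d t)) _ hg)
  rw [Finset.sum_mul, map_sum, Finset.sum_eq_single t] at h0
  · rw [smul_mul_assoc, map_smul, smul_eq_mul, basisMonomial, ← pow_add,
      add_tsub_cancel_of_le (basisExp_le t)] at h0
    exact mul_ne_zero ht.2 (hl _) h0
  · intro s _ hst
    rw [smul_mul_assoc, map_smul]
    by_cases hs : g s = 0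
    · rw [hs, zero_smul]
    · rw [residue_basisMonomial_mul_eq_zero hw0 hw hN hlI hlN hst (hmax s (by simpa using hs)),
        smul_zero]
  · simp

theorem span_basisMonomial_eq_top (hq : ∀ i, q i (d i) ≠ 0) (hw0 : ∀ i, 0 < w i)
    (hw : ∀ i, d i * w i + w i = N)
    (hN : ∀ i j k, i ≠ j → i ≠ k → j ≠ k → N < w i + w j + w k) :
    Submodule.span K (Set.range fun s =>
      Ideal.Quotient.mkₐ K (cuspIdeal d q) (basisMonomial K d s)) = ⊤ := by
  have h : ∀ s, basisMonomial K d s ∈ (Submodule.span K (Set.range fun s =>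
      Ideal.Quotient.mkₐ K (cuspIdeal d q) (basisMonomial K d s))).comap
        (Ideal.Quotient.mkₐ K (cuspIdeal d q)).toLinearMap :=
    fun s => Submodule.subset_span ⟨s, rfl⟩
  have htop := eq_top_of_cuspIdeal_le hq hw0 hw hN (S := (Submodule.span K (Set.range fun s =>
      Ideal.Quotient.mkₐ K (cuspIdeal d q) (basisMonomial K d s))).comap
        (Ideal.Quotient.mkₐ K (cuspIdeal d q)).toLinearMap) (fun p hp => ?_) (fun i k hk => ?_)
    (h (.inl (Fin.last _)))
  · rw [eq_top_iff]
    intro p _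
    obtain ⟨p, rfl⟩ := Ideal.Quotient.mkₐ_surjective K (cuspIdeal d q) p
    exact (htop ▸ Submodule.mem_top : p ∈ (Submodule.span K (Set.range fun s =>
      Ideal.Quotient.mkₐ K (cuspIdeal d q) (basisMonomial K d s))).comap
        (Ideal.Quotient.mkₐ K (cuspIdeal d q)).toLinearMap)
  · have : Ideal.Quotient.mkₐ K (cuspIdeal d q) p = 0 := Ideal.Quotient.eq_zero_iff_mem.2 hp
    rw [Submodule.mem_comap, AlgHom.toLinearMap_apply, this]
    exact zero_mem _
  · obtain ⟨s, hs⟩ := exists_basisMonomial_eq (K := K) hk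
    exact hs ▸ h s

theorem finiteDimensional_and_finrank_quotient_cuspIdeal (hq : ∀ i, q i (d i) ≠ 0)
    (hw0 : ∀ i, 0 < w i) (hw : ∀ i, d i * w i + w i = N)
    (hN : ∀ i j k, i ≠ j → i ≠ k → j ≠ k → N < w i + w j + w k) :
    FiniteDimensional K (MvPolynomial (Fin 3) K ⧸ cuspIdeal d q) ∧
      Module.finrank K (MvPolynomial (Fin 3) K ⧸ cuspIdeal d q) = d 0 + d 1 + d 2 + 2 := by
  let b := Module.Basis.mk (linearIndependent_basisMonomial hq hw0 hw hN)
    (span_basisMonomial_eq_top hq hw0 hw hN).ge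
  refine ⟨b.finiteDimensional_of_finite, ?_⟩
  rw [Module.finrank_eq_card_basis b]
  simp only [Fintype.card_sum, Fintype.card_fin]
  omega

end Cusp

/-- The coefficients of the derivative, multiplied by `sμ`, of the part of the cusp unfolding
involving only the variable `xᵢ`. -/
noncomputable def cuspCoeff (a : Fin 3 → ℕ) (sij : Fin 3 → ℕ → ℂ) (sμ : ℂ) (i : Fin 3) (j : ℕ) :
    ℂ :=
  sμ * ((j + 1) * if j + 1 = a i then 1 else sij i (j + 1))

theorem pderiv_cuspUnfolding (a : Fin 3 → ℕ) (ha : ∀ i, 0 < a i) (s1 : ℂ)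
    (sij : Fin 3 → ℕ → ℂ) (sμ : ℂ) (hsμ : sμ ≠ 0) (i : Fin 3) :
    pderiv i (cuspUnfolding a s1 sij sμ) = -C sμ⁻¹ *
      (X (i + 1) * X (i + 2) - branchPoly (fun i => a i - 1) (cuspCoeff a sij sμ) i) := by
  have hC : (C sμ⁻¹ * C sμ : MvPolynomial (Fin 3) ℂ) = 1 := by
    rw [← C_mul, inv_mul_cancel₀ hsμ, C_1]
  have hpow (c : ℂ) (k : Fin 3) (n : ℕ) : pderiv i (C c * X k ^ n) =
      if k = i then C c * ((n : MvPolynomial (Fin 3) ℂ) * X i ^ (n - 1)) else 0 := by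
    rw [pderiv_C_mul, pderiv_pow, pderiv_X]
    split_ifs with h
    · subst h; simp
    · simp [h]
  have hpow1 (k : Fin 3) (n : ℕ) : pderiv i (X k ^ n : MvPolynomial (Fin 3) ℂ) =
      if k = i then (n : MvPolynomial (Fin 3) ℂ) * X i ^ (n - 1) else 0 := by
    simpa using hpow 1 k n
  have hprod : pderiv i (X 0 * X 1 * X 2 : MvPolynomial (Fin 3) ℂ) = X (i + 1) * X (i + 2) := by
    fin_cases i <;> simp [pderiv_X]
    ring
  have hbranch : branchPoly (fun i => a i - 1) (cuspCoeff a sij sμ) i =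
      C sμ * ((a i : MvPolynomial (Fin 3) ℂ) * X i ^ (a i - 1) +
        ∑ j ∈ Finset.Ico 1 (a i),
          C (sij i j) * ((j : MvPolynomial (Fin 3) ℂ) * X i ^ (j - 1))) := by
    obtain ⟨n, hn⟩ : ∃ n, a i = n + 1 := ⟨a i - 1, by have := ha i; omega⟩
    rw [branchPoly, Finset.sum_range_succ, Finset.sum_Ico_eq_sum_range, mul_add, add_comm,
      Finset.mul_sum, hn, Nat.add_sub_cancel]
    congr 1
    · simp [cuspCoeff, hn, mul_assoc]
    · refine Finset.sum_congr rfl fun j hj => ?_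
      have hj' : j + 1 ≠ a i := by
        have := Finset.mem_range.1 hj
        omega
      rw [cuspCoeff, if_neg hj', Nat.add_sub_cancel_left, add_comm 1 j]
      simp only [C_mul, C_add, C_1, map_natCast, Nat.cast_add, Nat.cast_one]
      ring
  rw [cuspUnfolding, hbranch]
  simp only [map_add, map_sub, map_sum, hpow, hpow1, pderiv_C_mul, pderiv_C, hprod,
    Finset.sum_ite_irrel, Finset.sum_const_zero, Finset.sum_ite_eq', Finset.mem_univ, if_true]
  linear_combination (-((a i : MvPolynomial (Fin 3) ℂ) * X i ^ (a i - 1) +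
    ∑ j ∈ Finset.Ico 1 (a i), C (sij i j) * ((j : MvPolynomial (Fin 3) ℂ) * X i ^ (j - 1)))) * hC

theorem jacobianIdeal_cuspUnfolding (a : Fin 3 → ℕ) (ha : ∀ i, 0 < a i) (s1 : ℂ)
    (sij : Fin 3 → ℕ → ℂ) (sμ : ℂ) (hsμ : sμ ≠ 0) :
    jacobianIdeal (cuspUnfolding a s1 sij sμ) =
      cuspIdeal (fun i => a i - 1) (cuspCoeff a sij sμ) := by
  have h := pderiv_cuspUnfolding a ha s1 sij sμ hsμ
  have hu : IsUnit (-C sμ⁻¹ : MvPolynomial (Fin 3) ℂ) :=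
    ((isUnit_iff_ne_zero.2 (inv_ne_zero hsμ)).map C).neg
  rw [jacobianIdeal, cuspIdeal]
  refine le_antisymm ?_ ?_ <;> rw [Ideal.span_le, Set.range_subset_iff] <;> intro i
  · rw [h]
    exact Ideal.mul_mem_left _ _ (Ideal.subset_span ⟨i, rfl⟩)
  · rw [SetLike.mem_coe, ← Ideal.unit_mul_mem_iff_mem _ hu, ← h]
    exact Ideal.subset_span ⟨i, rfl⟩

/-- For every choice of parameters, the Jacobian ring of the universal unfolding of an affine
cusp polynomial is a finite-dimensional complex vector space of dimension
`μ_A = a₁ + a₂ + a₃ − 1`. -/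
theorem jacobianRing_finiteDimensional_and_finrank_eq_mu
    (a : Fin 3 → ℕ) (ha : ∀ i, 0 < a i)
    (hord : a 0 ≤ a 1 ∧ a 1 ≤ a 2)
    (hχ : 1 < (1 : ℚ) / (a 0) + 1 / (a 1) + 1 / (a 2))
    (s1 : ℂ) (sij : Fin 3 → ℕ → ℂ) (sμ : ℂ) (hsμ : sμ ≠ 0) :
    FiniteDimensional ℂ
        (MvPolynomial (Fin 3) ℂ ⧸ jacobianIdeal (cuspUnfolding a s1 sij sμ)) ∧
      Module.finrank ℂ
          (MvPolynomial (Fin 3) ℂ ⧸ jacobianIdeal (cuspUnfolding a s1 sij sμ)) =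
        a 0 + a 1 + a 2 - 1 := by
  have h0 := ha 0
  have h1 := ha 1
  have h2 := ha 2
  have hχ' : a 0 * a 1 * a 2 < a 1 * a 2 + a 2 * a 0 + a 0 * a 1 := by
    have h0' : (0 : ℚ) < a 0 := by exact_mod_cast h0
    have h1' : (0 : ℚ) < a 1 := by exact_mod_cast h1
    have h2' : (0 : ℚ) < a 2 := by exact_mod_cast h2
    rw [div_add_div _ _ h0'.ne' h1'.ne', div_add_div _ _ (by positivity) h2'.ne',
      lt_div_iff₀ (by positivity)] at hχ
    have h : (a 0 * a 1 * a 2 : ℚ) < a 1 * a 2 + a 2 * a 0 + a 0 * a 1 := by linarith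
    exact_mod_cast h
  have hq (i : Fin 3) : cuspCoeff a sij sμ i (a i - 1) ≠ 0 := by
    rw [cuspCoeff, if_pos (Nat.sub_add_cancel (ha i)), mul_one]
    exact mul_ne_zero hsμ (Nat.cast_add_one_ne_zero _)
  have key := finiteDimensional_and_finrank_quotient_cuspIdeal (d := fun i => a i - 1)
    (w := fun i => a (i + 1) * a (i + 2)) (N := a 0 * a 1 * a 2) hq
    (fun i => Nat.mul_pos (ha _) (ha _)) (fun i => ?_) (fun i j k hij hik hjk => ?_)
  · rw [jacobianIdeal_cuspUnfolding a ha s1 sij sμ hsμ]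
    refine ⟨key.1, key.2.trans ?_⟩
    omega
  · rw [← Nat.succ_mul, Nat.succ_eq_add_one, Nat.sub_add_cancel (ha i)]
    fin_cases i <;> simp <;> ring
  · fin_cases i <;> fin_cases j <;> fin_cases k <;> simp at hij hik hjk ⊢ <;> linarith
end

section
/- Let R := ℂ[s_1, (s_{i,j})_{1≤i≤3, 1≤j≤a_i−1}, s_μ] be the polynomial ring in μ_A variables over ℂ. In R[x_1,x_2,x_3], for i = 1,2,3 set G_i := s_μ·(a_i x_i^{a_i−1} + Σ_{j=1}^{a_i−1} j·s_{i,j}·x_i^{j−1}) − x_1x_2x_3/x_i (i.e. G_1 = s_μ(a_1x_1^{a_1−1}+Σ_j j s_{1,j}x_1^{j−1}) − x_2x_3, and similarly for G_2, G_3; these equal s_μ·∂F_A/∂x_i). Then the quotient R[x_1,x_2,x_3]/(G_1, G_2, G_3, H_1, H_2) is a free R-module of rank μ_A, and a basis is given by the residue classes of 1, x_i^j (i = 1,2,3, 1 ≤ j ≤ a_i−1), and a_1x_1^{a_1} + Σ_{j=1}^{a_1−1} j·s_{1,j}·x_1^j. -/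
open MvPolynomial

/-- Index type of cardinality `μ_A = a₁ + a₂ + a₃ − 1` for the parameter variables
`s₁`, `s_{i,j}` (`i = 1,2,3`, `1 ≤ j ≤ aᵢ − 1`) and `s_μ`. -/
abbrev MuIdx (a : Fin 3 → ℕ) : Type :=
  Unit ⊕ ((Σ i : Fin 3, {j : ℕ // j ∈ Finset.Ico 1 (a i)}) ⊕ Unit)

/-- `R = ℂ[s₁, s_{i,j}, s_μ]`, the polynomial ring in the `μ_A` parameter variables. -/
abbrev ParamRing (a : Fin 3 → ℕ) : Type := MvPolynomial (MuIdx a) ℂ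

/-- The variable `s_μ` of `R`. -/
noncomputable def sMu (a : Fin 3 → ℕ) : ParamRing a := X (Sum.inr (Sum.inr ()))

/-- The variable `s_{i,j}` of `R`. -/
noncomputable def sVar (a : Fin 3 → ℕ) (i : Fin 3) (j : {j : ℕ // j ∈ Finset.Ico 1 (a i)}) :
    ParamRing a := X (Sum.inr (Sum.inl ⟨i, j⟩))

/-- The polynomial `aᵢ xᵢ^{aᵢ} + Σ_{j=1}^{aᵢ−1} j s_{i,j} xᵢʲ` in `R[x₁,x₂,x₃]`,
so that `H₁ = gpart 0 − gpart 1` and `H₂ = gpart 1 − gpart 2`. -/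
noncomputable def gpart (a : Fin 3 → ℕ) (i : Fin 3) : MvPolynomial (Fin 3) (ParamRing a) :=
  (a i : MvPolynomial (Fin 3) (ParamRing a)) * X i ^ a i
    + ∑ j ∈ (Finset.Ico 1 (a i)).attach,
        ((j : ℕ) : MvPolynomial (Fin 3) (ParamRing a)) * C (sVar a i j) * X i ^ (j : ℕ)

/-- `G i = s_μ·(aᵢ xᵢ^{aᵢ−1} + Σ_{j=1}^{aᵢ−1} j s_{i,j} xᵢ^{j−1}) − x₁x₂x₃/xᵢ`
(which equals `s_μ·∂F_A/∂xᵢ`). -/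
noncomputable def gDer (a : Fin 3 → ℕ) (i : Fin 3) : MvPolynomial (Fin 3) (ParamRing a) :=
  C (sMu a) * ((a i : MvPolynomial (Fin 3) (ParamRing a)) * X i ^ (a i - 1)
      + ∑ j ∈ (Finset.Ico 1 (a i)).attach,
          ((j : ℕ) : MvPolynomial (Fin 3) (ParamRing a)) * C (sVar a i j) * X i ^ ((j : ℕ) - 1))
    - ∏ k ∈ Finset.univ.erase i, X k

/-- The ideal `(G₁, G₂, G₃, H₁, H₂)` of `R[x₁,x₂,x₃]`. -/
noncomputable def extIdeal (a : Fin 3 → ℕ) : Ideal (MvPolynomial (Fin 3) (ParamRing a)) :=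
  Ideal.span {gDer a 0, gDer a 1, gDer a 2, gpart a 0 - gpart a 1, gpart a 1 - gpart a 2}

/-- The family of residue classes of `1`, `xᵢʲ` (`i = 1,2,3`, `1 ≤ j ≤ aᵢ−1`) and
`a₁x₁^{a₁} + Σ_{j=1}^{a₁−1} j s_{1,j} x₁ʲ` in the quotient. -/
noncomputable def extFam (a : Fin 3 → ℕ) :
    MuIdx a → (MvPolynomial (Fin 3) (ParamRing a) ⧸ extIdeal a) := fun k =>
  Ideal.Quotient.mk (extIdeal a) <|
    match k with
    | Sum.inl _ => 1
    | Sum.inr (Sum.inl ⟨i, j⟩) => X i ^ (j : ℕ)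
    | Sum.inr (Sum.inr _) => gpart a 0


lemma mem_span_quintuple_iff {A : Type*} [CommRing A] {p q r y z f : A} :
    f ∈ Ideal.span {p, q, r, y, z} ↔
      ∃ b c d u v, f = b * p + c * q + d * r + u * y + v * z := by
  simp only [Ideal.mem_span_insert, Ideal.mem_span_singleton']
  constructor
  · rintro ⟨b, _, ⟨c, _, ⟨d, _, ⟨u, _, ⟨v, rfl⟩, rfl⟩, rfl⟩, rfl⟩, rfl⟩
    exact ⟨b, c, d, u, v, by ring⟩
  · rintro ⟨b, c, d, u, v, rfl⟩
    exact ⟨b, _, ⟨c, _, ⟨d, _, ⟨u, _, ⟨v, rfl⟩, rfl⟩, rfl⟩, rfl⟩, by ring⟩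

lemma mem_span_triple_iff {A : Type*} [CommRing A] {p q r f : A} :
    f ∈ Ideal.span {p, q, r} ↔ ∃ b c d, f = b * p + c * q + d * r := by
  simp only [Ideal.mem_span_insert, Ideal.mem_span_singleton']
  constructor
  · rintro ⟨b, _, ⟨c, _, ⟨d, rfl⟩, rfl⟩, rfl⟩
    exact ⟨b, c, d, by ring⟩
  · rintro ⟨b, c, d, rfl⟩
    exact ⟨b, _, ⟨c, _, ⟨d, rfl⟩, rfl⟩, by ring⟩

/-- The ideal generated by `s hᵢ - xⱼ xₖ` and `x₁ h₁ - x₂ h₂`, `x₂ h₂ - x₃ h₃` is saturated with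
respect to `s`, provided the coordinate subspaces of `s = 0` are integral. -/
lemma mem_span_of_mul_mem {A : Type*} [CommRing A] [IsDomain A]
    {s x₁ x₂ x₃ h₁ h₂ h₃ f : A} (hs : (Ideal.span {s}).IsPrime) (hs0 : s ≠ 0)
    (p₁ : (Ideal.span {s, x₁}).IsPrime) (p₂ : (Ideal.span {s, x₂}).IsPrime)
    (p₃ : (Ideal.span {s, x₃}).IsPrime) (p₁₂ : (Ideal.span {s, x₁, x₂}).IsPrime)
    (p₁₃ : (Ideal.span {s, x₁, x₃}).IsPrime) (p₂₃ : (Ideal.span {s, x₂, x₃}).IsPrime)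
    (n : x₁ * (x₂ * x₃) ∉ Ideal.span {s})
    (n₁ : x₂ * x₃ ∉ Ideal.span {s, x₁}) (n₂ : x₁ * x₃ ∉ Ideal.span {s, x₂})
    (n₃ : x₁ * x₂ ∉ Ideal.span {s, x₃}) (n₁₂ : x₃ * h₃ ∉ Ideal.span {s, x₁, x₂})
    (n₁₃ : x₂ * h₂ ∉ Ideal.span {s, x₁, x₃}) (n₂₃ : x₁ * h₁ ∉ Ideal.span {s, x₂, x₃})
    (hf : s * f ∈ Ideal.span {s * h₁ - x₂ * x₃, s * h₂ - x₁ * x₃, s * h₃ - x₁ * x₂,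
      x₁ * h₁ - x₂ * h₂, x₂ * h₂ - x₃ * h₃}) :
    f ∈ Ideal.span {s * h₁ - x₂ * x₃, s * h₂ - x₁ * x₃, s * h₃ - x₁ * x₂,
      x₁ * h₁ - x₂ * h₂, x₂ * h₂ - x₃ * h₃} := by
  obtain ⟨f₁, f₂, f₃, u, v, hF⟩ := mem_span_quintuple_iff.1 hf
  obtain ⟨u₀, u₂, u₃, hu⟩ := mem_span_triple_iff.1 <|
    (p₂₃.mem_or_mem (x := x₁ * h₁) (y := u) (mem_span_triple_iff.2
      ⟨f - f₁ * h₁ - f₂ * h₂ - f₃ * h₃, f₁ * x₃ + f₃ * x₁ + u * h₂ - v * h₂, f₂ * x₁ + v * h₃,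
        by linear_combination -hF⟩)).resolve_left n₂₃
  obtain ⟨v₀, v₁, v₂, hv⟩ := mem_span_triple_iff.1 <|
    (p₁₂.mem_or_mem (x := x₃ * h₃) (y := v) (mem_span_triple_iff.2
      ⟨f₁ * h₁ + f₂ * h₂ + f₃ * h₃ - f, -f₂ * x₃ - f₃ * x₂ + u * h₁, -f₁ * x₃ - u * h₂ + v * h₂,
        by linear_combination hF⟩)).resolve_left n₁₂
  obtain ⟨w₀, w₁, w₃, hw⟩ := mem_span_triple_iff.1 <|
    (p₁₃.mem_or_mem (x := x₂ * h₂) (y := v - u) (mem_span_triple_iff.2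
      ⟨f - f₁ * h₁ - f₂ * h₂ - f₃ * h₃, f₂ * x₃ + f₃ * x₂ - u * h₁, f₁ * x₂ + v * h₃,
        by linear_combination -hF⟩)).resolve_left n₁₃
  obtain ⟨z₀, z₁, z₃, hz⟩ := mem_span_triple_iff.1 <|
    (p₁₃.mem_or_mem (x := x₂) (y := v₂ - u₂) (mem_span_triple_iff.2
      ⟨w₀ - v₀ + u₀, w₁ - v₁, w₃ + u₃, by linear_combination hw + hu - hv⟩)).resolve_left
        fun h => n₁₃ (Ideal.mul_mem_right _ _ h)
  obtain ⟨g₁, hg₁⟩ : ∃ g, g = f₁ + u₃ * h₂ + u₂ * h₃ + z₃ * x₃ * h₃ - z₃ * x₂ * h₂ := ⟨_, rfl⟩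
  obtain ⟨g₂, hg₂⟩ : ∃ g, g = f₂ - u₃ * h₁ + v₁ * h₃ + z₁ * x₂ * h₃ + z₃ * x₂ * h₁ := ⟨_, rfl⟩
  obtain ⟨g₃, hg₃⟩ : ∃ g, g = f₃ - v₁ * h₂ - u₂ * h₁ - z₁ * x₂ * h₂ - z₃ * x₃ * h₁ := ⟨_, rfl⟩
  have hG : s * f = s * (u₀ * (x₁ * h₁ - x₂ * h₂) + (v₀ + z₀ * x₂) * (x₂ * h₂ - x₃ * h₃))
      + g₁ * (s * h₁ - x₂ * x₃) + g₂ * (s * h₂ - x₁ * x₃) + g₃ * (s * h₃ - x₁ * x₂) := by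
    rw [hg₁, hg₂, hg₃]
    linear_combination hF + (x₁ * h₁ - x₂ * h₂) * hu + (x₂ * h₂ - x₃ * h₃) * hv
      + x₂ * (x₂ * h₂ - x₃ * h₃) * hz
  obtain ⟨k, hk⟩ : ∃ k, k = u₀ * (x₁ * h₁ - x₂ * h₂) + (v₀ + z₀ * x₂) * (x₂ * h₂ - x₃ * h₃)
      + g₁ * h₁ + g₂ * h₂ + g₃ * h₃ - f := ⟨_, rfl⟩
  have hK : s * k = g₁ * (x₂ * x₃) + g₂ * (x₁ * x₃) + g₃ * (x₁ * x₂) := by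
    rw [hk]; linear_combination -hG
  obtain ⟨a₁, b₁, e₁⟩ := Ideal.mem_span_pair.1 <|
    (p₁.mem_or_mem (x := x₂ * x₃) (y := g₁) (Ideal.mem_span_pair.2
      ⟨k, -g₂ * x₃ - g₃ * x₂, by linear_combination hK⟩)).resolve_left n₁
  obtain ⟨a₂, b₂, e₂⟩ := Ideal.mem_span_pair.1 <|
    (p₂.mem_or_mem (x := x₁ * x₃) (y := g₂) (Ideal.mem_span_pair.2
      ⟨k, -g₁ * x₃ - g₃ * x₁, by linear_combination hK⟩)).resolve_left n₂
  obtain ⟨a₃, b₃, e₃⟩ := Ideal.mem_span_pair.1 <|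
    (p₃.mem_or_mem (x := x₁ * x₂) (y := g₃) (Ideal.mem_span_pair.2
      ⟨k, -g₁ * x₂ - g₂ * x₁, by linear_combination hK⟩)).resolve_left n₃
  obtain ⟨c, hc⟩ := Ideal.mem_span_singleton'.1 <|
    (hs.mem_or_mem (x := x₁ * (x₂ * x₃)) (y := b₁ + b₂ + b₃) (Ideal.mem_span_singleton'.2
      ⟨k - a₁ * (x₂ * x₃) - a₂ * (x₁ * x₃) - a₃ * (x₁ * x₂), by
        linear_combination hK - (x₂ * x₃) * e₁ - (x₁ * x₃) * e₂ - (x₁ * x₂) * e₃⟩)).resolve_left n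
  refine mem_span_quintuple_iff.2
    ⟨a₁, a₂ + c * x₂, a₃, u₀ + b₁, v₀ + z₀ * x₂ - b₃, mul_left_cancel₀ hs0 ?_⟩
  linear_combination hG - (s * h₁ - x₂ * x₃) * e₁ - (s * h₂ - x₁ * x₃) * e₂
    - (s * h₃ - x₁ * x₂) * e₃ - x₂ * (s * h₂ - x₁ * x₃) * hc

/-- The derivative of the `i`-th one-variable summand of the unfolding. -/
noncomputable def derPart (a : Fin 3 → ℕ) (i : Fin 3) : MvPolynomial (Fin 3) (ParamRing a) :=
  (a i : MvPolynomial (Fin 3) (ParamRing a)) * X i ^ (a i - 1)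
    + ∑ j ∈ (Finset.Ico 1 (a i)).attach,
        ((j : ℕ) : MvPolynomial (Fin 3) (ParamRing a)) * C (sVar a i j) * X i ^ ((j : ℕ) - 1)

lemma gpart_eq_X_mul_derPart {a : Fin 3 → ℕ} {i : Fin 3} (hi : 0 < a i) :
    gpart a i = X i * derPart a i := by
  rw [gpart, derPart, mul_add, Finset.mul_sum, mul_left_comm, mul_pow_sub_one hi.ne']
  refine congrArg _ (Finset.sum_congr rfl fun j _ => ?_)
  rw [mul_left_comm, mul_pow_sub_one (Nat.pos_iff_ne_zero.1 (Finset.mem_Ico.1 j.2).1)]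

lemma gDer_eq {a : Fin 3 → ℕ} {i j k : Fin 3} (h : Finset.univ.erase i = {j, k}) (hjk : j ≠ k) :
    gDer a i = C (sMu a) * derPart a i - X j * X k := by
  rw [gDer, h, Finset.prod_pair hjk, derPart]

lemma extIdeal_eq {a : Fin 3 → ℕ} (ha : ∀ i, 0 < a i) :
    extIdeal a = Ideal.span {C (sMu a) * derPart a 0 - X 1 * X 2,
      C (sMu a) * derPart a 1 - X 0 * X 2, C (sMu a) * derPart a 2 - X 0 * X 1,
      X 0 * derPart a 0 - X 1 * derPart a 1, X 1 * derPart a 1 - X 2 * derPart a 2} := by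
  simp_rw [← gpart_eq_X_mul_derPart (ha _)]
  rw [extIdeal, gDer_eq (i := 0) (j := 1) (k := 2) (by decide) (by decide),
    gDer_eq (i := 1) (j := 0) (k := 2) (by decide) (by decide),
    gDer_eq (i := 2) (j := 0) (k := 1) (by decide) (by decide)]

/-- The endomorphism of the parameter ring setting `s_μ` to zero. -/
noncomputable def killMu (a : Fin 3 → ℕ) : ParamRing a →ₐ[ℂ] ParamRing a :=
  aeval fun k => if k = Sum.inr (Sum.inr ()) then 0 else X k

@[simp]
lemma killMu_sMu (a : Fin 3 → ℕ) : killMu a (sMu a) = 0 := by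
  simp [killMu, sMu]

@[simp]
lemma killMu_sVar (a : Fin 3 → ℕ) (i : Fin 3) (j : {j : ℕ // j ∈ Finset.Ico 1 (a i)}) :
    killMu a (sVar a i j) = sVar a i j := by
  simp [killMu, sVar]

lemma sMu_dvd_of_killMu_eq_zero {a : Fin 3 → ℕ} {p : ParamRing a} (hp : killMu a p = 0) :
    sMu a ∣ p := by
  have key : ((Ideal.Quotient.mkₐ ℂ (Ideal.span {sMu a})).comp (killMu a))
      = Ideal.Quotient.mkₐ ℂ (Ideal.span {sMu a}) := by
    refine MvPolynomial.algHom_ext fun k => ?_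
    by_cases hk : k = Sum.inr (Sum.inr ())
    · subst hk
      change Ideal.Quotient.mk _ (killMu a (sMu a)) = Ideal.Quotient.mk _ (sMu a)
      rw [killMu_sMu, map_zero, eq_comm, Ideal.Quotient.eq_zero_iff_mem]
      exact Ideal.mem_span_singleton_self _
    · simp [killMu, hk]
  have := DFunLike.congr_fun key p
  rw [AlgHom.comp_apply, hp, map_zero, eq_comm] at this
  exact Ideal.mem_span_singleton.1 (Ideal.Quotient.eq_zero_iff_mem.1 this)

open Classical in
/-- The endomorphism of `R[x₁, x₂, x₃]` setting `s_μ` and the variables in `T` to zero. -/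
noncomputable def killVars (a : Fin 3 → ℕ) (T : Set (Fin 3)) :
    MvPolynomial (Fin 3) (ParamRing a) →+* MvPolynomial (Fin 3) (ParamRing a) :=
  eval₂Hom (C.comp (killMu a).toRingHom) fun k => if k ∈ T then 0 else X k

lemma span_insert_eq_ker (a : Fin 3 → ℕ) (T : Set (Fin 3)) :
    Ideal.span (insert (C (sMu a)) (X '' T)) = RingHom.ker (killVars a T) := by
  apply le_antisymm
  · rw [Ideal.span_le]
    rintro _ (rfl | ⟨k, hk, rfl⟩)
    · simp [killVars, RingHom.mem_ker]
    · simp [killVars, RingHom.mem_ker, hk]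
  · set J : Ideal (MvPolynomial (Fin 3) (ParamRing a)) :=
      Ideal.span (insert (C (sMu a)) (X '' T))
    have key : (Ideal.Quotient.mk J).comp (killVars a T) = Ideal.Quotient.mk J := by
      refine MvPolynomial.ringHom_ext' (MvPolynomial.ringHom_ext' ?_ fun k => ?_) fun k => ?_
      · refine RingHom.ext fun z => ?_
        simp only [killVars, RingHom.comp_apply, eval₂Hom_C, AlgHom.toRingHom_eq_coe,
          RingHom.coe_coe, algHom_C, algebraMap_eq]
      · by_cases hk : k = Sum.inr (Sum.inr ())
        · subst hk
          simp only [killVars, killMu, RingHom.comp_apply, eval₂Hom_C, AlgHom.toRingHom_eq_coe,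
            RingHom.coe_coe, aeval_X, if_true, map_zero]
          rw [eq_comm, Ideal.Quotient.eq_zero_iff_mem]
          exact Ideal.subset_span (Set.mem_insert _ _)
        · simp [killVars, killMu, hk]
      · by_cases hk : k ∈ T
        · simp only [killVars, RingHom.comp_apply, eval₂Hom_X', hk, if_true, map_zero]
          rw [eq_comm, Ideal.Quotient.eq_zero_iff_mem]
          exact Ideal.subset_span (Set.mem_insert_of_mem _ ⟨k, hk, rfl⟩)
        · simp [killVars, hk]
    intro p hp
    have := DFunLike.congr_fun key p
    rw [RingHom.comp_apply, (RingHom.mem_ker).1 hp, map_zero, eq_comm] at this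
    exact Ideal.Quotient.eq_zero_iff_mem.1 this

lemma isPrime_span_insert (a : Fin 3 → ℕ) (T : Set (Fin 3)) :
    (Ideal.span (insert (C (sMu a)) (X '' T))).IsPrime := by
  rw [span_insert_eq_ker]
  exact RingHom.ker_isPrime _

lemma X_notMem_span_insert (a : Fin 3 → ℕ) {T : Set (Fin 3)} {i : Fin 3} (hi : i ∉ T) :
    X i ∉ Ideal.span (insert (C (sMu a)) (X '' T)) := by
  rw [span_insert_eq_ker, RingHom.mem_ker]
  simp [killVars, hi]

/-- Restriction to the `i`-th coordinate axis over `s_μ = 0`. -/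
noncomputable def axisMap (a : Fin 3 → ℕ) (i : Fin 3) :
    MvPolynomial (Fin 3) (ParamRing a) →+* Polynomial (ParamRing a) :=
  eval₂Hom (Polynomial.C.comp (killMu a).toRingHom) fun k => if k = i then Polynomial.X else 0

@[simp]
lemma axisMap_C (a : Fin 3 → ℕ) (i : Fin 3) (p : ParamRing a) :
    axisMap a i (C p) = Polynomial.C (killMu a p) := by
  simp [axisMap]

@[simp]
lemma axisMap_X_self (a : Fin 3 → ℕ) (i : Fin 3) : axisMap a i (X i) = Polynomial.X := by
  simp [axisMap]

lemma axisMap_X_of_ne (a : Fin 3 → ℕ) {i k : Fin 3} (h : k ≠ i) : axisMap a i (X k) = 0 := by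
  simp [axisMap, h]

lemma coeff_zero_axisMap (a : Fin 3 → ℕ) (i : Fin 3) (p : MvPolynomial (Fin 3) (ParamRing a)) :
    (axisMap a i p).coeff 0 = killMu a (constantCoeff p) := by
  have : (Polynomial.constantCoeff).comp (axisMap a i)
      = (killMu a).toRingHom.comp constantCoeff := by
    refine MvPolynomial.ringHom_ext (fun p => by simp) fun k => ?_
    by_cases hk : k = i
    · subst hk; simp
    · simp [axisMap_X_of_ne a hk]
  exact DFunLike.congr_fun this p

lemma axisMap_gpart_of_ne {a : Fin 3 → ℕ} (ha : ∀ i, 0 < a i) {i k : Fin 3} (h : k ≠ i) :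
    axisMap a i (gpart a k) = 0 := by
  rw [gpart_eq_X_mul_derPart (ha k), map_mul, axisMap_X_of_ne a h, zero_mul]

lemma degree_axisMap_gpart (a : Fin 3 → ℕ) (ha : ∀ i, 0 < a i) (i : Fin 3) :
    (axisMap a i (gpart a i)).degree = a i := by
  have hai : (a i : ParamRing a) ≠ 0 := Nat.cast_ne_zero.2 (ha i).ne'
  have h1 : ((Polynomial.C (a i : ParamRing a)) * Polynomial.X ^ a i).degree = (a i : WithBot ℕ) :=
    Polynomial.degree_C_mul_X_pow _ hai
  simp only [gpart, map_add, map_mul, map_pow, map_natCast, axisMap_X_self, map_sum, axisMap_C]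
  rw [← map_natCast Polynomial.C, Polynomial.degree_add_eq_left_of_degree_lt, h1]
  rw [h1]
  refine (Polynomial.degree_sum_le _ _).trans_lt ?_
  rw [Finset.sup_lt_iff (WithBot.bot_lt_coe _)]
  intro j _
  rw [← map_natCast Polynomial.C, ← map_mul]
  exact (Polynomial.degree_C_mul_X_pow_le _ _).trans_lt
    (WithBot.coe_lt_coe.2 (Finset.mem_Ico.1 j.2).2)

lemma axisMap_gpart_ne_zero (a : Fin 3 → ℕ) (ha : ∀ i, 0 < a i) (i : Fin 3) :
    axisMap a i (gpart a i) ≠ 0 := by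
  intro h
  have := degree_axisMap_gpart a ha i
  rw [h] at this
  simp at this

lemma gpart_notMem_span_insert (a : Fin 3 → ℕ) (ha : ∀ i, 0 < a i) {T : Set (Fin 3)} {i : Fin 3}
    (hi : i ∉ T) : gpart a i ∉ Ideal.span (insert (C (sMu a)) (X '' T)) := by
  intro h
  refine axisMap_gpart_ne_zero a ha i (RingHom.mem_ker.1 ((Ideal.span_le.2 ?_ :
    Ideal.span (insert (C (sMu a)) (X '' T)) ≤ RingHom.ker (axisMap a i)) h))
  rintro _ (rfl | ⟨k, hk, rfl⟩)
  · simp [RingHom.mem_ker]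
  · exact axisMap_X_of_ne a fun h => hi (h ▸ hk)

lemma mem_extIdeal_of_sMu_mul_mem {a : Fin 3 → ℕ} (ha : ∀ i, 0 < a i)
    {f : MvPolynomial (Fin 3) (ParamRing a)} (hf : C (sMu a) * f ∈ extIdeal a) :
    f ∈ extIdeal a := by
  rw [extIdeal_eq ha] at hf ⊢
  have hP := isPrime_span_insert a
  have hX := fun T i (hi : i ∉ T) => X_notMem_span_insert a hi
  have hg := fun T i (hi : i ∉ T) => gpart_notMem_span_insert a ha hi
  have hmul : ∀ (T : Set (Fin 3)) (i j : Fin 3), i ∉ T → j ∉ T →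
      X i * X j ∉ Ideal.span (insert (C (sMu a)) (X '' T)) := fun T i j hi hj h =>
    ((hP T).mem_or_mem h).elim (hX T i hi) (hX T j hj)
  have hmul₃ : (X 0 * (X 1 * X 2) : MvPolynomial (Fin 3) (ParamRing a)) ∉
      Ideal.span (insert (C (sMu a)) (X '' ∅)) := fun h =>
    ((hP ∅).mem_or_mem h).elim (hX ∅ 0 (by simp)) (hmul ∅ 1 2 (by simp) (by simp))
  have q : ∀ i, (Ideal.span {C (sMu a), X i}).IsPrime := fun i => by simpa using hP {i}
  have q₂ : ∀ i j, (Ideal.span {C (sMu a), X i, X j}).IsPrime := fun i j => by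
    simpa [Set.image_pair] using hP {i, j}
  refine mem_span_of_mul_mem (by simpa using hP ∅) ?_ (q 0) (q 1) (q 2) (q₂ 0 1) (q₂ 0 2) (q₂ 1 2)
    (by simpa using hmul₃) (by simpa using hmul {0} 1 2 (by simp) (by simp))
    (by simpa using hmul {1} 0 2 (by simp) (by simp))
    (by simpa using hmul {2} 0 1 (by simp) (by simp)) ?_ ?_ ?_ hf
  · rw [Ne, C_eq_zero]
    exact X_ne_zero _
  all_goals rw [← gpart_eq_X_mul_derPart (ha _)]
  · simpa [Set.image_pair] using hg {0, 1} 2 (by simp)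
  · simpa [Set.image_pair] using hg {0, 2} 1 (by simp)
  · simpa [Set.image_pair] using hg {1, 2} 0 (by simp)

/-- The combination of the family `1`, `xᵢʲ`, `gpart a 0` with coefficients `c`. -/
noncomputable def famComb (a : Fin 3 → ℕ) (c : MuIdx a → ParamRing a) :
    MvPolynomial (Fin 3) (ParamRing a) :=
  C (c (Sum.inl ())) + ∑ i : Fin 3, ∑ j : {j : ℕ // j ∈ Finset.Ico 1 (a i)},
      C (c (Sum.inr (Sum.inl ⟨i, j⟩))) * X i ^ (j : ℕ)
    + C (c (Sum.inr (Sum.inr ()))) * gpart a 0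

lemma sum_smul_extFam (a : Fin 3 → ℕ) (c : MuIdx a → ParamRing a) :
    ∑ k, c k • extFam a k = Ideal.Quotient.mk (extIdeal a) (famComb a c) := by
  have h : ∀ (r : ParamRing a) (p : MvPolynomial (Fin 3) (ParamRing a)),
      r • Ideal.Quotient.mk (extIdeal a) p = Ideal.Quotient.mk (extIdeal a) (C r * p) :=
    fun r p => by rw [← smul_eq_C_mul]; rfl
  simp only [Fintype.sum_sum_type, Fintype.sum_sigma, extFam, h, ← map_sum, map_add, famComb,
    Finset.univ_unique, Finset.sum_singleton, mul_one, add_assoc]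

lemma famComb_mul (a : Fin 3 → ℕ) (r : ParamRing a) (c : MuIdx a → ParamRing a) :
    famComb a (fun k => r * c k) = C r * famComb a c := by
  simp only [famComb, C_mul, mul_add, Finset.mul_sum, mul_assoc]

lemma eq_zero_of_lowDegree_eq_mul {R : Type*} [CommRing R] [IsDomain R] {n : ℕ} (hn : 0 < n)
    {c₀ : R} {c : {j : ℕ // j ∈ Finset.Ico 1 n} → R} {w g : Polynomial R} (hg : g.degree = n)
    (h : Polynomial.C c₀
      + ∑ j : {j : ℕ // j ∈ Finset.Ico 1 n}, Polynomial.C (c j) * Polynomial.X ^ (j : ℕ) = w * g) :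
    w = 0 ∧ c₀ = 0 ∧ ∀ j, c j = 0 := by
  have hlt : (w * g).degree < n := by
    rw [← h]
    refine (Polynomial.degree_add_le _ _).trans_lt (max_lt
      (Polynomial.degree_C_le.trans_lt (by exact_mod_cast hn)) ?_)
    refine (Polynomial.degree_sum_le _ _).trans_lt ?_
    rw [Finset.sup_lt_iff (WithBot.bot_lt_coe _)]
    exact fun j _ => (Polynomial.degree_C_mul_X_pow_le _ _).trans_lt
      (WithBot.coe_lt_coe.2 (Finset.mem_Ico.1 j.2).2)
  have hw : w = 0 := by
    by_contra hw
    rw [Polynomial.degree_mul, hg, Polynomial.degree_eq_natDegree hw] at hlt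
    have : w.natDegree + n < n := by exact_mod_cast hlt
    omega
  rw [hw, zero_mul] at h
  refine ⟨hw, ?_, fun j => ?_⟩
  · have h0 := congrArg (Polynomial.coeff · 0) h
    simp only [Polynomial.coeff_add, Polynomial.coeff_C_zero, Polynomial.finsetSum_coeff,
      Polynomial.coeff_C_mul_X_pow, Polynomial.coeff_zero] at h0
    rwa [Finset.sum_eq_zero, add_zero] at h0
    intro j _
    rw [if_neg (Nat.pos_iff_ne_zero.1 (Finset.mem_Ico.1 j.2).1).symm]
  · have hj0 : (j : ℕ) ≠ 0 := Nat.pos_iff_ne_zero.1 (Finset.mem_Ico.1 j.2).1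
    have h0 := congrArg (Polynomial.coeff · (j : ℕ)) h
    simp only [Polynomial.coeff_add, Polynomial.coeff_C, hj0, if_false,
      Polynomial.finsetSum_coeff, Polynomial.coeff_C_mul_X_pow, Polynomial.coeff_zero,
      Subtype.coe_inj, Finset.sum_ite_eq, Finset.mem_univ, if_true, zero_add] at h0
    exact h0

lemma axisMap_famComb (a : Fin 3 → ℕ) (c : MuIdx a → ParamRing a) (i : Fin 3) :
    axisMap a i (famComb a c) = Polynomial.C (killMu a (c (Sum.inl ())))
      + ∑ j : {j : ℕ // j ∈ Finset.Ico 1 (a i)},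
          Polynomial.C (killMu a (c (Sum.inr (Sum.inl ⟨i, j⟩)))) * Polynomial.X ^ (j : ℕ)
      + Polynomial.C (killMu a (c (Sum.inr (Sum.inr ())))) * axisMap a i (gpart a 0) := by
  simp only [famComb, map_add, map_sum, map_mul, map_pow, axisMap_C]
  rw [Finset.sum_eq_single i _ (by simp)]
  · simp only [axisMap_X_self]
  · intro k _ hk
    refine Finset.sum_eq_zero fun j _ => ?_
    rw [axisMap_X_of_ne a hk, zero_pow (Nat.pos_iff_ne_zero.1 (Finset.mem_Ico.1 j.2).1), mul_zero]

lemma sMu_dvd_of_famComb_mem {a : Fin 3 → ℕ} (ha : ∀ i, 0 < a i) {c : MuIdx a → ParamRing a}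
    (hc : famComb a c ∈ extIdeal a) (k : MuIdx a) : sMu a ∣ c k := by
  rw [extIdeal_eq ha] at hc
  obtain ⟨f₁, f₂, f₃, u, v, h⟩ := mem_span_quintuple_iff.1 hc
  simp_rw [← gpart_eq_X_mul_derPart (ha _)] at h
  have e := fun i => (axisMap_famComb a c i).symm.trans (congrArg (axisMap a i) h)
  simp only [map_add, map_mul, map_sub, axisMap_C, killMu_sMu, map_zero, zero_mul, zero_sub] at e
  have e₀ := e 0
  have e₁ := e 1
  have e₂ := e 2
  have z := fun i k (hk : k ≠ i) => axisMap_gpart_of_ne ha hk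
  have x := fun i k (hk : k ≠ i) => axisMap_X_of_ne a hk
  rw [x 0 1 (by decide), x 0 2 (by decide), z 0 1 (by decide), z 0 2 (by decide)] at e₀
  rw [x 1 0 (by decide), x 1 2 (by decide), z 1 0 (by decide), z 1 2 (by decide)] at e₁
  rw [x 2 0 (by decide), x 2 1 (by decide), z 2 0 (by decide), z 2 1 (by decide)] at e₂
  have hg := degree_axisMap_gpart a ha
  let r₀ := killMu a (c (Sum.inl ()))
  let r := fun i (j : {j : ℕ // j ∈ Finset.Ico 1 (a i)}) =>
    killMu a (c (Sum.inr (Sum.inl ⟨i, j⟩)))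
  obtain ⟨w₂, c₀, c₂⟩ := eq_zero_of_lowDegree_eq_mul (ha 2) (hg 2) (c₀ := r₀) (c := r 2)
    (w := -axisMap a 2 v) (by linear_combination e₂)
  obtain ⟨w₁, -, c₁⟩ := eq_zero_of_lowDegree_eq_mul (ha 1) (hg 1) (c₀ := r₀) (c := r 1)
    (w := axisMap a 1 v - axisMap a 1 u) (by linear_combination e₁)
  obtain ⟨w₀, -, c₃⟩ := eq_zero_of_lowDegree_eq_mul (ha 0) (hg 0) (c₀ := r₀) (c := r 0)
    (w := axisMap a 0 u - Polynomial.C (killMu a (c (Sum.inr (Sum.inr ())))))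
    (by linear_combination e₀)
  have hv : killMu a (constantCoeff v) = 0 := by
    rw [← coeff_zero_axisMap a 2, neg_eq_zero.1 w₂, Polynomial.coeff_zero]
  have hu : killMu a (constantCoeff u) = 0 := by
    rw [← hv, ← coeff_zero_axisMap a 1, ← coeff_zero_axisMap a 1, sub_eq_zero.1 w₁]
  apply sMu_dvd_of_killMu_eq_zero
  match k with
  | Sum.inl () => exact c₀
  | Sum.inr (Sum.inl ⟨0, j⟩) => exact c₃ j
  | Sum.inr (Sum.inl ⟨1, j⟩) => exact c₁ j
  | Sum.inr (Sum.inl ⟨2, j⟩) => exact c₂ j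
  | Sum.inr (Sum.inr ()) =>
    rw [← hu, ← coeff_zero_axisMap a 0, sub_eq_zero.1 w₀, Polynomial.coeff_C_zero]

lemma sMu_pow_dvd_of_famComb_mem {a : Fin 3 → ℕ} (ha : ∀ i, 0 < a i) (n : ℕ) :
    ∀ c : MuIdx a → ParamRing a, famComb a c ∈ extIdeal a → ∀ k, sMu a ^ n ∣ c k := by
  induction n with
  | zero => simp
  | succ n ih =>
    intro c hc k
    choose d hd using sMu_dvd_of_famComb_mem ha hc
    rw [funext hd, famComb_mul] at hc
    rw [hd, pow_succ']
    exact mul_dvd_mul_left _ (ih d (mem_extIdeal_of_sMu_mul_mem ha hc) k)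

lemma linearIndependent_extFam {a : Fin 3 → ℕ} (ha : ∀ i, 0 < a i) :
    LinearIndependent (ParamRing a) (extFam a) := by
  rw [Fintype.linearIndependent_iff]
  intro c hc k
  rw [sum_smul_extFam, Ideal.Quotient.eq_zero_iff_mem] at hc
  by_contra hk
  have hunit : ¬ IsUnit (sMu a) := (MvPolynomial.X_prime).not_isUnit
  obtain ⟨n, hn⟩ := FiniteMultiplicity.of_not_isUnit hunit hk
  exact hn (sMu_pow_dvd_of_famComb_mem ha _ c hc k)

lemma gDer_mem_extIdeal (a : Fin 3 → ℕ) (i : Fin 3) : gDer a i ∈ extIdeal a := by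
  apply Ideal.subset_span
  fin_cases i <;> simp

lemma gpart_sub_mem_extIdeal (a : Fin 3 → ℕ) (i j : Fin 3) :
    gpart a i - gpart a j ∈ extIdeal a := by
  have h₁ : gpart a 0 - gpart a 1 ∈ extIdeal a := Ideal.subset_span (by simp)
  have h₂ : gpart a 1 - gpart a 2 ∈ extIdeal a := Ideal.subset_span (by simp)
  have h : ∀ i, gpart a 0 - gpart a i ∈ extIdeal a := fun i => by
    fin_cases i
    · simp
    · exact h₁
    · simpa using add_mem h₁ h₂
  simpa using sub_mem (h j) (h i)

lemma X_mul_X_sub_mem_extIdeal {a : Fin 3 → ℕ} {i j k : Fin 3}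
    (h : Finset.univ.erase k = {i, j}) (hij : i ≠ j) :
    X i * X j - C (sMu a) * derPart a k ∈ extIdeal a := by
  have := neg_mem (gDer_mem_extIdeal a k)
  rwa [gDer_eq h hij, neg_sub] at this

/-- Polynomials all of whose monomials have `w`-weight at most `n`. -/
noncomputable def weightLE (R : Type*) [CommSemiring R] {σ : Type*} (w : σ → ℕ) (n : ℕ) :
    Submodule R (MvPolynomial σ R) :=
  restrictSupport R {d | Finsupp.weight w d ≤ n}

section weightLE

variable {R : Type*} [CommSemiring R] {σ : Type*} {w : σ → ℕ}

lemma weightLE_mono {m n : ℕ} (h : m ≤ n) : weightLE R w m ≤ weightLE R w n :=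
  restrictSupport_mono _ fun _ hd => le_trans hd h

lemma mul_mem_weightLE {m n : ℕ} {p q : MvPolynomial σ R} (hp : p ∈ weightLE R w m)
    (hq : q ∈ weightLE R w n) : p * q ∈ weightLE R w (m + n) := by
  have := Submodule.mul_mem_mul hp hq
  rw [weightLE, weightLE, ← restrictSupport_add] at this
  refine restrictSupport_mono _ ?_ this
  rintro _ ⟨d, hd, e, he, rfl⟩
  simp only [Set.mem_ofPred_eq, map_add] at *
  exact add_le_add hd he

lemma monomial_mem_weightLE (d : σ →₀ ℕ) (r : R) :
    monomial d r ∈ weightLE R w (Finsupp.weight w d) :=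
  (monomial_mem_restrictSupport R).2 (Or.inl (by simp))

lemma C_mem_weightLE (r : R) (n : ℕ) : C r ∈ weightLE R w n :=
  weightLE_mono (Nat.zero_le _) (by simpa using monomial_mem_weightLE (w := w) 0 r)

lemma X_pow_mem_weightLE (i : σ) (m : ℕ) : X i ^ m ∈ weightLE R w (m * w i) := by
  have := monomial_mem_weightLE (w := w) (Finsupp.single i m) (1 : R)
  rwa [Finsupp.weight_single, smul_eq_mul, ← X_pow_eq_monomial] at this

lemma C_mul_mem_weightLE (r : R) {n : ℕ} {p : MvPolynomial σ R} (hp : p ∈ weightLE R w n) :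
    C r * p ∈ weightLE R w n := by
  rw [← smul_eq_C_mul]
  exact Submodule.smul_mem _ _ hp

end weightLE

/-- The weights making every `xᵢ^{aᵢ}` have the same weight `a₀ a₁ a₂`. -/
def cuspWeight (a : Fin 3 → ℕ) : Fin 3 → ℕ := ![a 1 * a 2, a 0 * a 2, a 0 * a 1]

lemma mul_cuspWeight (a : Fin 3 → ℕ) (i : Fin 3) : a i * cuspWeight a i = a 0 * a 1 * a 2 := by
  fin_cases i <;> simp [cuspWeight] <;> ring

lemma natCast_eq_C (a : Fin 3 → ℕ) (n : ℕ) :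
    (n : MvPolynomial (Fin 3) (ParamRing a)) = C (n : ParamRing a) :=
  (map_natCast C n).symm

lemma derPart_mem_weightLE (a : Fin 3 → ℕ) (i : Fin 3) {n : ℕ}
    (hn : a 0 * a 1 * a 2 ≤ n + cuspWeight a i) :
    derPart a i ∈ weightLE (ParamRing a) (cuspWeight a) n := by
  have key : ∀ m, m ≤ a i - 1 →
      (X i ^ m : MvPolynomial (Fin 3) (ParamRing a)) ∈ weightLE _ (cuspWeight a) n := by
    intro m hm
    refine weightLE_mono ?_ (X_pow_mem_weightLE i m)
    refine (Nat.mul_le_mul_right _ hm).trans ?_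
    rw [Nat.sub_mul, mul_cuspWeight]
    omega
  rw [derPart]
  refine add_mem ?_ (sum_mem fun j _ => ?_)
  · rw [natCast_eq_C]
    exact C_mul_mem_weightLE _ (key _ le_rfl)
  · rw [natCast_eq_C, mul_assoc]
    exact C_mul_mem_weightLE _ (C_mul_mem_weightLE _
      (key _ (Nat.sub_le_sub_right (Finset.mem_Ico.1 j.2).2.le 1)))

/-- The polynomials whose residue class is spanned by the family `extFam`. -/
noncomputable def famSpan (a : Fin 3 → ℕ) :
    Submodule (ParamRing a) (MvPolynomial (Fin 3) (ParamRing a)) :=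
  (Submodule.span (ParamRing a) (Set.range (extFam a))).comap
    (Ideal.Quotient.mkₐ (ParamRing a) (extIdeal a)).toLinearMap

lemma mem_famSpan_of_sub_mem {a : Fin 3 → ℕ} {p q : MvPolynomial (Fin 3) (ParamRing a)}
    (h : p - q ∈ extIdeal a) (hq : q ∈ famSpan a) : p ∈ famSpan a := by
  have : Ideal.Quotient.mk (extIdeal a) p = Ideal.Quotient.mk (extIdeal a) q :=
    Ideal.Quotient.eq.2 h
  change Ideal.Quotient.mk (extIdeal a) p ∈ Submodule.span (ParamRing a) (Set.range (extFam a))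
  rw [this]
  exact hq

lemma X_pow_mem_famSpan (a : Fin 3 → ℕ) {i : Fin 3} {m : ℕ} (hm : m < a i) :
    X i ^ m ∈ famSpan a := by
  rcases Nat.eq_zero_or_pos m with rfl | h
  · rw [pow_zero]
    exact Submodule.subset_span ⟨Sum.inl (), rfl⟩
  · exact Submodule.subset_span ⟨Sum.inr (Sum.inl ⟨i, m, Finset.mem_Ico.2 ⟨h, hm⟩⟩), rfl⟩

lemma gpart_mem_famSpan (a : Fin 3 → ℕ) (i : Fin 3) : gpart a i ∈ famSpan a :=
  mem_famSpan_of_sub_mem (gpart_sub_mem_extIdeal a i 0)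
    (Submodule.subset_span ⟨Sum.inr (Sum.inr ()), rfl⟩)

lemma X_pow_add_mem_famSpan {a : Fin 3 → ℕ} {i : Fin 3} (hi : 0 < a i) {e : ℕ}
    (hlow : ∀ m < a i, X i ^ (e + m) ∈ famSpan a) (hg : X i ^ e * gpart a i ∈ famSpan a) :
    X i ^ (e + a i) ∈ famSpan a := by
  have hsum : X i ^ e * (∑ j ∈ (Finset.Ico 1 (a i)).attach,
      ((j : ℕ) : MvPolynomial (Fin 3) (ParamRing a)) * C (sVar a i j) * X i ^ (j : ℕ))
        ∈ famSpan a := by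
    rw [Finset.mul_sum]
    refine sum_mem fun j _ => ?_
    rw [natCast_eq_C, ← C_mul, mul_left_comm, ← pow_add, ← smul_eq_C_mul]
    exact Submodule.smul_mem _ _ (hlow _ (Finset.mem_Ico.1 j.2).2)
  have h := sub_mem hg hsum
  rw [← mul_sub, gpart, add_sub_cancel_right, natCast_eq_C, mul_left_comm, ← pow_add,
    ← smul_eq_C_mul] at h
  have hu : (C (a i : ℂ)⁻¹ : ParamRing a) * (a i : ParamRing a) = 1 := by
    rw [← map_natCast C, ← C_mul, inv_mul_cancel₀ (Nat.cast_ne_zero.2 hi.ne'), C_1]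
  simpa [smul_smul, hu] using Submodule.smul_mem _ (C (a i : ℂ)⁻¹ : ParamRing a) h

lemma weightLE_le_famSpan {a : Fin 3 → ℕ} (ha : ∀ i, 0 < a i)
    (hχ : a 0 * a 1 * a 2 < cuspWeight a 0 + cuspWeight a 1 + cuspWeight a 2) (n : ℕ) :
    weightLE (ParamRing a) (cuspWeight a) n ≤ famSpan a := by
  have hk : ∀ i j : Fin 3, i ≠ j → ∃ k, Finset.univ.erase k = {i, j} := by decide
  have hsum : ∀ i j k : Fin 3, i ≠ j → Finset.univ.erase k = {i, j} →
      a 0 * a 1 * a 2 < cuspWeight a i + cuspWeight a j + cuspWeight a k := by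
    intro i j k hij h
    rw [← Finset.sum_pair hij, ← h, Finset.sum_erase_add _ _ (Finset.mem_univ k),
      Fin.sum_univ_three]
    exact hχ
  have hpos : ∀ i, 0 < cuspWeight a i := fun i => Nat.pos_of_mul_pos_left (a := a i) (by
    rw [mul_cuspWeight]; exact Nat.mul_pos (Nat.mul_pos (ha 0) (ha 1)) (ha 2))
  have hle : ∀ i, cuspWeight a i ≤ a 0 * a 1 * a 2 := fun i => by
    rw [← mul_cuspWeight a i]; exact Nat.le_mul_of_pos_left _ (ha i)
  induction n using Nat.strong_induction_on with
  | _ n ih =>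
  rw [weightLE, restrictSupport_eq_span, Submodule.span_le]
  rintro _ ⟨d, hd, rfl⟩
  change Finsupp.weight _ d ≤ n at hd
  change monomial d 1 ∈ famSpan a
  by_cases hmix : ∃ i j, i ≠ j ∧ d i ≠ 0 ∧ d j ≠ 0
  · obtain ⟨i, j, hij, hi, hj⟩ := hmix
    obtain ⟨k, hk⟩ := hk i j hij
    obtain ⟨d', rfl⟩ : ∃ d', d = d' + (Finsupp.single i 1 + Finsupp.single j 1) := by
      refine ⟨d - (Finsupp.single i 1 + Finsupp.single j 1), (tsub_add_cancel_of_le ?_).symm⟩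
      intro l
      rcases eq_or_ne l i with rfl | hl
      · simpa [Finsupp.single_apply, hij.symm] using Nat.one_le_iff_ne_zero.2 hi
      · rcases eq_or_ne l j with rfl | hl'
        · simpa [Finsupp.single_apply, hij] using Nat.one_le_iff_ne_zero.2 hj
        · simp [hl.symm, hl'.symm]
    have hmon : (monomial (d' + (Finsupp.single i 1 + Finsupp.single j 1)) 1
        : MvPolynomial (Fin 3) (ParamRing a)) = monomial d' 1 * (X i * X j) := by
      simp [X, monomial_mul]
    rw [hmon]
    refine mem_famSpan_of_sub_mem (q := monomial d' 1 * (C (sMu a) * derPart a k)) ?_ ?_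
    · rw [← mul_sub]
      exact Ideal.mul_mem_left _ _ (X_mul_X_sub_mem_extIdeal hk hij)
    · have h3 := hsum i j k hij hk
      have h4 := hle k
      simp only [map_add, Finsupp.weight_single, smul_eq_mul, one_mul] at hd
      refine ih (Finsupp.weight (cuspWeight a) d' + (a 0 * a 1 * a 2 - cuspWeight a k))
        (by omega) (mul_mem_weightLE (monomial_mem_weightLE _ _)
          (C_mul_mem_weightLE _ (derPart_mem_weightLE a k (by omega))))
  · push Not at hmix
    obtain ⟨i, m, rfl⟩ : ∃ i m, d = Finsupp.single i m := by
      by_cases h0 : d = 0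
      · exact ⟨0, 0, by simp [h0]⟩
      · obtain ⟨i, hi⟩ := Finsupp.ne_iff.1 h0
        refine ⟨i, d i, Finsupp.ext fun l => ?_⟩
        rcases eq_or_ne i l with rfl | hl
        · simp
        · rw [Finsupp.single_eq_of_ne hl.symm, hmix i l hl hi]
    rw [← X_pow_eq_monomial]
    rw [Finsupp.weight_single, smul_eq_mul] at hd
    rcases lt_or_ge m (a i) with hm | hm
    · exact X_pow_mem_famSpan a hm
    obtain ⟨e, rfl⟩ := Nat.exists_eq_add_of_le' hm
    refine X_pow_add_mem_famSpan (ha i) (fun m hm => ?_) ?_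
    · exact ih ((e + m) * cuspWeight a i) (lt_of_lt_of_le
        (Nat.mul_lt_mul_of_pos_right (by omega) (hpos i)) hd) (X_pow_mem_weightLE _ _)
    rcases e with _ | e
    · rw [pow_zero, one_mul]
      exact gpart_mem_famSpan a i
    obtain ⟨j, hij⟩ : ∃ j, i ≠ j := (exists_ne i).imp fun _ h => h.symm
    obtain ⟨k, hk⟩ := hk i j hij
    have h1 : X i ^ (e + 1) * gpart a i - X i ^ e * (X i * X j) * derPart a j ∈ extIdeal a := by
      have := Ideal.mul_mem_left _ (X i ^ (e + 1)) (gpart_sub_mem_extIdeal a i j)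
      rw [mul_sub, gpart_eq_X_mul_derPart (ha j), pow_succ] at this
      rw [pow_succ]
      simpa only [mul_assoc] using this
    have h2 : X i ^ e * (X i * X j) * derPart a j
        - X i ^ e * (C (sMu a) * derPart a k) * derPart a j ∈ extIdeal a := by
      rw [← sub_mul, ← mul_sub]
      exact Ideal.mul_mem_right _ _ (Ideal.mul_mem_left _ _ (X_mul_X_sub_mem_extIdeal hk hij))
    refine mem_famSpan_of_sub_mem h1 (mem_famSpan_of_sub_mem h2 ?_)
    have h3 := hsum i j k hij hk
    have h4 := hle k
    have h5 := hle j
    rw [add_mul, mul_cuspWeight, add_mul, one_mul] at hd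
    exact ih (e * cuspWeight a i + (a 0 * a 1 * a 2 - cuspWeight a k)
        + (a 0 * a 1 * a 2 - cuspWeight a j)) (by omega)
      (mul_mem_weightLE (mul_mem_weightLE (X_pow_mem_weightLE _ _)
        (C_mul_mem_weightLE _ (derPart_mem_weightLE a k (by omega))))
        (derPart_mem_weightLE a j (by omega)))

lemma span_range_extFam {a : Fin 3 → ℕ} (ha : ∀ i, 0 < a i)
    (hχ : a 0 * a 1 * a 2 < cuspWeight a 0 + cuspWeight a 1 + cuspWeight a 2) :
    Submodule.span (ParamRing a) (Set.range (extFam a)) = ⊤ := by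
  rw [eq_top_iff]
  intro q _
  obtain ⟨p, rfl⟩ := Ideal.Quotient.mk_surjective q
  change p ∈ famSpan a
  rw [p.as_sum]
  exact sum_mem fun d _ => weightLE_le_famSpan ha hχ _ (monomial_mem_weightLE d _)

lemma card_muIdx {a : Fin 3 → ℕ} (ha : ∀ i, 0 < a i) :
    Fintype.card (MuIdx a) = a 0 + a 1 + a 2 - 1 := by
  have h₀ := ha 0
  have h₁ := ha 1
  have h₂ := ha 2
  simp only [Fintype.card_sum, Fintype.card_unit, Fintype.card_sigma, Fin.sum_univ_three,
    Fintype.card_coe, Nat.card_Ico]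
  omega

lemma lt_sum_cuspWeight {a : Fin 3 → ℕ} (ha : ∀ i, 0 < a i)
    (hχ : 1 < (1 : ℚ) / (a 0) + 1 / (a 1) + 1 / (a 2)) :
    a 0 * a 1 * a 2 < cuspWeight a 0 + cuspWeight a 1 + cuspWeight a 2 := by
  have h₀ : (0 : ℚ) < a 0 := Nat.cast_pos.2 (ha 0)
  have h₁ : (0 : ℚ) < a 1 := Nat.cast_pos.2 (ha 1)
  have h₂ : (0 : ℚ) < a 2 := Nat.cast_pos.2 (ha 2)
  have h := mul_lt_mul_of_pos_left hχ (mul_pos (mul_pos h₀ h₁) h₂)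
  have e : (a 0 * a 1 * a 2 : ℚ) * (1 / (a 0) + 1 / (a 1) + 1 / (a 2))
      = a 1 * a 2 + a 0 * a 2 + a 0 * a 1 := by
    field_simp
  rw [e, mul_one] at h
  simp only [cuspWeight, Matrix.cons_val]
  exact_mod_cast h

/-- `R[x₁,x₂,x₃]/(G₁,G₂,G₃,H₁,H₂)` is a free `R`-module of rank `μ_A`, with basis given by
the residue classes of `1`, `xᵢʲ` (`i = 1,2,3`, `1 ≤ j ≤ aᵢ−1`) and
`a₁x₁^{a₁} + Σ_{j=1}^{a₁−1} j s_{1,j} x₁ʲ`. -/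
theorem extQuotient_free_of_rank_mu
    (a : Fin 3 → ℕ) (ha : ∀ i, 0 < a i)
    (hord : a 0 ≤ a 1 ∧ a 1 ≤ a 2)
    (hχ : 1 < (1 : ℚ) / (a 0) + 1 / (a 1) + 1 / (a 2)) :
    Module.Free (ParamRing a) (MvPolynomial (Fin 3) (ParamRing a) ⧸ extIdeal a) ∧
      Module.finrank (ParamRing a) (MvPolynomial (Fin 3) (ParamRing a) ⧸ extIdeal a) =
        a 0 + a 1 + a 2 - 1 ∧
      LinearIndependent (ParamRing a) (extFam a) ∧
      Submodule.span (ParamRing a) (Set.range (extFam a)) = ⊤ := by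
  have hli := linearIndependent_extFam ha
  have hsp := span_range_extFam ha (lt_sum_cuspWeight ha hχ)
  let b := Module.Basis.mk hli hsp.ge
  exact ⟨Module.Free.of_basis b, (Module.finrank_eq_card_basis b).trans (card_muIdx ha), hli, hsp⟩
end
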